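/- arXiv:1510.03036 — 2 statements merged into one kernel-verified Lean document; each statement's English description precedes it below -/
import Mathlib

section
/- Define the 4-tensor P^{ijls}_{(k)} = 2^{-k} δ^{i_1...i_{2k-2} i j}_{j_1...j_{2k-2} j_{2k-1} j_{2k}} R_{i_1 i_2}^{j_1 j_2} ⋯ R_{i_{2k-3} i_{2k-2}}^{j_{2k-3} j_{2k-2}} g^{j_{2k-1} l} g^{j_{2k} s}. Then P_{(k)} has the symmetries of an algebraic curvature tensor: P^{ijls} = −P^{jils} = −P^{ijsl} = P^{lsij}, and it satisfies the first Bianchi-type identity P^{ijls} + P^{ilsj} + P^{isjl} = 0. -/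
/-- The generalized Kronecker delta. -/
noncomputable def gkd {ι : Type*} [DecidableEq ι] {r : ℕ} (j i : Fin r → ι) : ℝ :=
  Matrix.det (Matrix.of fun a b : Fin r => if j a = i b then (1 : ℝ) else 0)

/-- The 4-tensor `P_{(k)}` (here written with `k = m + 1`):
`P^{ijls}_{(k)} = 2^{-k} δ^{i_1...i_{2k-2} i j}_{j_1...j_{2k-2} j_{2k-1} j_{2k}}
  R_{i_1i_2}^{j_1j_2} ⋯ R_{i_{2k-3}i_{2k-2}}^{j_{2k-3}j_{2k-2}} g^{j_{2k-1} l} g^{j_{2k} s}`,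
in an orthonormal basis (`g^{ab} = δ^{ab}`). -/
noncomputable def Pk (n m : ℕ) (R : Fin n → Fin n → Fin n → Fin n → ℝ)
    (i j l s : Fin n) : ℝ :=
  (2 ^ (m + 1) : ℝ)⁻¹ * ∑ α : Fin (2 * m) → Fin n, ∑ β : Fin (2 * m) → Fin n,
    gkd (Fin.snoc (Fin.snoc α i) j) (Fin.snoc (Fin.snoc β l) s) * ∏ a : Fin m,
      R (α ⟨2 * (a : ℕ), by have := a.isLt; omega⟩)
        (α ⟨2 * (a : ℕ) + 1, by have := a.isLt; omega⟩)
        (β ⟨2 * (a : ℕ), by have := a.isLt; omega⟩)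
        (β ⟨2 * (a : ℕ) + 1, by have := a.isLt; omega⟩)

open Equiv in
theorem gkd_swap {ι : Type*} [DecidableEq ι] {r : ℕ} (u u' v : Fin r → ι) (p q : Fin r)
    (hpq : p ≠ q) (h : ∀ x, u' x = u (swap p q x)) : gkd u' v = - gkd u v := by
  obtain rfl : u' = fun x => u (swap p q x) := funext h
  have := Matrix.det_permute (swap p q)
    (Matrix.of fun a b : Fin r => if u a = v b then (1 : ℝ) else 0)
  rw [Perm.sign_swap hpq] at this
  unfold gkd
  simp only [Units.val_neg, Units.val_one, Int.cast_neg, Int.cast_one, neg_mul, one_mul] at this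
  exact this

theorem gkd_symm {ι : Type*} [DecidableEq ι] {r : ℕ} (u v : Fin r → ι) :
    gkd u v = gkd v u := by
  unfold gkd
  rw [← Matrix.det_transpose]
  congr 1
  ext a b
  simp [Matrix.transpose_apply, eq_comm]

open Equiv in
/-- The exchange identity for the generalized Kronecker delta. -/
theorem gkd_exchange {ι : Type*} [DecidableEq ι] {r : ℕ} (u w : Fin r → ι) (p : Fin r) :
    gkd u w = ∑ c, gkd (Function.update u p (w c)) (Function.update w c (u p)) := by
  classical
  set f : Fin r → Perm (Fin r) → ℝ := fun c σ => ((Perm.sign σ : ℤ) : ℝ) * ∏ b,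
    (if Function.update u p (w c) (σ b) = Function.update w c (u p) b then (1 : ℝ) else 0) with hf
  set A : Perm (Fin r) → ℝ := fun σ => ((Perm.sign σ : ℤ) : ℝ) * ∏ b,
    (if u (σ b) = w b then (1 : ℝ) else 0) with hA
  have e1 : gkd u w = ∑ σ, A σ := by
    simp [gkd, Matrix.det_apply', hA]
  have e2 : ∀ c, gkd (Function.update u p (w c)) (Function.update w c (u p)) = ∑ σ, f c σ := by
    intro c
    simp [gkd, Matrix.det_apply', hf]
  have split : ∀ c σ, f c σ = (if σ c = p then A σ else 0) + (if σ c = p then 0 else f c σ) := by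
    intro c σ
    by_cases h : σ c = p
    · simp only [h, if_true, add_zero, hf, hA]
      congr 1
      refine Finset.prod_congr rfl fun b _ => ?_
      by_cases hb : b = c
      · subst hb
        simp [h, eq_comm]
      · have : σ b ≠ p := fun h' => hb (σ.injective (h'.trans h.symm))
        simp [hb, this]
    · simp [h]
  have z : ∑ x : Fin r × Perm (Fin r), (if x.2 x.1 = p then 0 else f x.1 x.2) = 0 := by
    refine Finset.sum_involution
      (fun x _ => (x.2.symm p, x.2 * swap x.1 (x.2.symm p))) ?_ ?_ (by simp) ?_
    · rintro ⟨c, σ⟩ -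
      by_cases h : σ c = p
      · have : σ.symm p = c := by simp [← h]
        simp [this, h]
      · have hd : σ.symm p ≠ c := fun h' => h (by simp [← h'])
        obtain ⟨d, hd'⟩ : ∃ d, d = σ.symm p := ⟨_, rfl⟩
        have hp : σ d = p := by simp [hd']
        simp only [← hd'] at hd ⊢
        have hσ : (σ * swap c d) d = σ c := by simp
        rw [hσ]
        simp only [h, if_false, hf]
        have : ∏ b, (if Function.update u p (w d) ((σ * swap c d) b)
              = Function.update w d (u p) b then (1 : ℝ) else 0) =
            ∏ b, (if Function.update u p (w c) (σ b) = Function.update w c (u p) b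
              then (1 : ℝ) else 0) := by
          refine Fintype.prod_equiv (swap c d) _ _ fun b => ?_
          by_cases hbc : b = c
          · subst hbc
            simp [hp, hd, Ne.symm hd, eq_comm]
          by_cases hbd : b = d
          · subst hbd
            simp [h]
          have : σ b ≠ p := fun h' => hbd (σ.injective (h'.trans hp.symm))
          simp [swap_apply_of_ne_of_ne hbc hbd, hbc, hbd, this]
        rw [this, Perm.sign_mul, Perm.sign_swap (Ne.symm hd)]
        simp
    · rintro ⟨c, σ⟩ - hne heq
      have h : σ.symm p = c := congrArg Prod.fst heq
      apply hne
      have : σ c = p := by simp [← h]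
      simp [this]
    · rintro ⟨c, σ⟩ -
      have h1 : (σ * swap c (σ.symm p)).symm p = c := by
        rw [Equiv.symm_apply_eq]; simp
      ext1
      · exact h1
      · simp only
        rw [h1, mul_assoc, swap_comm (σ.symm p) c, swap_mul_self, mul_one]
  rw [e1, Finset.sum_congr rfl fun c _ => e2 c,
    Finset.sum_congr rfl fun c _ => Finset.sum_congr rfl fun σ _ => split c σ]
  simp only [Finset.sum_add_distrib]
  rw [Fintype.sum_prod_type] at z
  rw [z, add_zero, Finset.sum_comm]
  refine Finset.sum_congr rfl fun σ _ => ?_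
  rw [Finset.sum_eq_single (σ.symm p)]
  · simp
  · intro c _ hc
    rw [if_neg]
    rintro rfl
    simp at hc
  · simp

open Equiv in
theorem sum_cyc_zero {I X : Type*} [Fintype I] [DecidableEq I] [Fintype X]
    (H T : (I → X) → ℝ) (p q t : I)
    (h1 : ∀ γ, H (γ ∘ swap p q) = - H γ) (h2 : ∀ γ, H (γ ∘ swap q t) = - H γ)
    (hT : ∀ γ, T γ + T ((γ ∘ swap p q) ∘ swap q t) + T ((γ ∘ swap q t) ∘ swap p q) = 0) :
    ∑ γ, H γ * T γ = 0 := by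
  have key : ∀ (a b : Perm I), (∀ γ, H ((γ ∘ a) ∘ b) = H γ) →
      ∑ γ, H γ * T γ = ∑ γ, H γ * T ((γ ∘ a) ∘ b) := by
    intro a b h
    have := Equiv.sum_comp (Equiv.arrowCongr (b.symm * a.symm : Perm I) (Equiv.refl X))
      (fun γ => H γ * T γ)
    rw [← this]
    refine Finset.sum_congr rfl fun γ _ => ?_
    have e : (Equiv.arrowCongr (b.symm * a.symm : Perm I) (Equiv.refl X)) γ = (γ ∘ a) ∘ b := by
      ext x
      rfl
    rw [e, h]
  have k1 := key (swap p q) (swap q t) (fun γ => by rw [h2, h1, neg_neg])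
  have k2 := key (swap q t) (swap p q) (fun γ => by rw [h1, h2, neg_neg])
  have : ∑ γ, H γ * T γ + ∑ γ, H γ * T ((γ ∘ swap p q) ∘ swap q t)
      + ∑ γ, H γ * T ((γ ∘ swap q t) ∘ swap p q) = 0 := by
    rw [← Finset.sum_add_distrib, ← Finset.sum_add_distrib]
    refine Finset.sum_eq_zero fun γ _ => ?_
    rw [← mul_add, ← mul_add, hT, mul_zero]
  linarith

/-- The product of curvature factors. -/
noncomputable def Tprod (n m : ℕ) (R : Fin n → Fin n → Fin n → Fin n → ℝ)
    (α β : Fin (2 * m) → Fin n) : ℝ :=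
  ∏ a : Fin m,
      R (α ⟨2 * (a : ℕ), by have := a.isLt; omega⟩)
        (α ⟨2 * (a : ℕ) + 1, by have := a.isLt; omega⟩)
        (β ⟨2 * (a : ℕ), by have := a.isLt; omega⟩)
        (β ⟨2 * (a : ℕ) + 1, by have := a.isLt; omega⟩)

theorem Pk_eq (n m : ℕ) (R : Fin n → Fin n → Fin n → Fin n → ℝ) (i j l s : Fin n) :
    Pk n m R i j l s = (2 ^ (m + 1) : ℝ)⁻¹ * ∑ α : Fin (2 * m) → Fin n,
      ∑ β : Fin (2 * m) → Fin n,
      gkd (Fin.snoc (Fin.snoc α i) j) (Fin.snoc (Fin.snoc β l) s) * Tprod n m R α β := rfl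

/-- Two extra entries appended. -/
def ext2 {X : Type*} {r : ℕ} (α : Fin r → X) (i j : X) : Fin (r + 1 + 1) → X :=
  Fin.snoc (Fin.snoc α i : Fin (r + 1) → X) j

@[simp] theorem ext2_last {X : Type*} {r : ℕ} (α : Fin r → X) (i j : X) :
    ext2 α i j (Fin.last _) = j := by simp [ext2]

@[simp] theorem ext2_mid {X : Type*} {r : ℕ} (α : Fin r → X) (i j : X) :
    ext2 α i j (Fin.last r).castSucc = i := by simp [ext2]

@[simp] theorem ext2_cast {X : Type*} {r : ℕ} (α : Fin r → X) (i j : X) (x : Fin r) :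
    ext2 α i j x.castSucc.castSucc = α x := by simp [ext2]

theorem forall_fin2 {r : ℕ} {P : Fin (r + 1 + 1) → Prop} (h0 : P (Fin.last _))
    (h1 : P (Fin.last r).castSucc) (h2 : ∀ x : Fin r, P x.castSucc.castSucc) : ∀ x, P x :=
  fun x => Fin.lastCases h0 (fun y => Fin.lastCases h1 h2 y) x

theorem cc_ne_last {r : ℕ} (x : Fin r) : x.castSucc.castSucc ≠ Fin.last (r + 1) :=
  Fin.castSucc_ne_last _

theorem cc_ne_mid {r : ℕ} (x : Fin r) : x.castSucc.castSucc ≠ (Fin.last r).castSucc :=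
  fun h => Fin.castSucc_ne_last x (Fin.castSucc_injective _ h)

theorem mid_ne_last {r : ℕ} : (Fin.last r).castSucc ≠ Fin.last (r + 1) :=
  Fin.castSucc_ne_last _

open Equiv in
theorem gkd_flip {X : Type*} [DecidableEq X] {r : ℕ} (α : Fin r → X) (i j : X)
    (v : Fin (r + 1 + 1) → X) : gkd (ext2 α i j) v = - gkd (ext2 α j i) v := by
  refine gkd_swap _ _ _ (Fin.last r).castSucc (Fin.last _) mid_ne_last ?_
  refine forall_fin2 (by simp) (by simp) fun x => ?_
  rw [swap_apply_of_ne_of_ne (cc_ne_mid x) (cc_ne_last x)]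
  simp

theorem ext2_update_last {X : Type*} {r : ℕ} (α : Fin r → X) (i j x : X) :
    Function.update (ext2 α i j) (Fin.last _) x = ext2 α i x := by
  ext1 y
  revert y
  refine forall_fin2 (by simp) (by simp [mid_ne_last]) fun y => by simp [cc_ne_last]

theorem ext2_update_mid {X : Type*} {r : ℕ} (α : Fin r → X) (i j x : X) :
    Function.update (ext2 α i j) (Fin.last r).castSucc x = ext2 α x j := by
  ext1 y
  revert y
  refine forall_fin2 (by simp [mid_ne_last.symm]) (by simp) fun y => by simp [cc_ne_mid]

theorem ext2_update_cast {X : Type*} {r : ℕ} (α : Fin r → X) (i j x : X) (c : Fin r) :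
    Function.update (ext2 α i j) c.castSucc.castSucc x = ext2 (Function.update α c x) i j := by
  ext1 y
  revert y
  refine forall_fin2 (by simp [(cc_ne_last c).symm]) (by simp [(cc_ne_mid c).symm]) fun y => ?_
  by_cases h : y = c
  · subst h; simp
  · simp [h]

theorem gkd_bianchi {X : Type*} [DecidableEq X] {r : ℕ} (α β : Fin r → X) (i j l s : X) :
    gkd (ext2 α i j) (ext2 β l s) =
      (∑ c : Fin r, gkd (ext2 α i (β c)) (ext2 (Function.update β c j) l s))
      + gkd (ext2 α i l) (ext2 β j s) + gkd (ext2 α i s) (ext2 β l j) := by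
  rw [gkd_exchange _ _ (Fin.last _), Fin.sum_univ_castSucc, Fin.sum_univ_castSucc]
  simp only [ext2_update_last, ext2_update_mid, ext2_update_cast, ext2_last, ext2_mid, ext2_cast]

open Equiv in
theorem middle_zero {n m : ℕ} (R : Fin n → Fin n → Fin n → Fin n → ℝ)
    (h1 : ∀ i j l s, R i j l s = - R j i l s)
    (h2 : ∀ i j l s, R i j l s = - R i j s l)
    (h3 : ∀ i j l s, R i j l s = R l s i j)
    (hb : ∀ i j l s, R i j l s + R i l s j + R i s j l = 0)
    (i j l s : Fin n) (c : Fin (2 * m)) :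
    ∑ α : Fin (2 * m) → Fin n, ∑ β : Fin (2 * m) → Fin n,
      gkd (ext2 α i (β c)) (ext2 (Function.update β c j) l s) * Tprod n m R α β = 0 := by
  have hcm := c.isLt
  set a : Fin m := ⟨(c : ℕ) / 2, by omega⟩ with ha
  obtain ⟨a0, ha0⟩ : ∃ a0 : Fin (2 * m), (a0 : ℕ) = 2 * (a : ℕ) :=
    ⟨⟨2 * (a : ℕ), by have := a.isLt; omega⟩, rfl⟩
  obtain ⟨a1, ha1⟩ : ∃ a1 : Fin (2 * m), (a1 : ℕ) = 2 * (a : ℕ) + 1 :=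
    ⟨⟨2 * (a : ℕ) + 1, by have := a.isLt; omega⟩, rfl⟩
  have h01 : a0 ≠ a1 := fun h => by have := congrArg Fin.val h; omega
  have hc : c = a0 ∨ c = a1 := by
    rcases Nat.mod_two_eq_zero_or_one (c : ℕ) with h | h
    · left; ext; rw [ha0, ha]; simp only; omega
    · right; ext; rw [ha1, ha]; simp only; omega
  set p : Fin (2 * m) ⊕ Fin (2 * m) := Sum.inl a0 with hp
  set q : Fin (2 * m) ⊕ Fin (2 * m) := Sum.inl a1 with hq
  set t : Fin (2 * m) ⊕ Fin (2 * m) := Sum.inr c with ht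
  have hpq : p ≠ q := by simpa [hp, hq] using h01
  have hpt : p ≠ t := by simp [hp, ht]
  have hqt : q ≠ t := by simp [hq, ht]
  set H : (Fin (2 * m) ⊕ Fin (2 * m) → Fin n) → ℝ := fun γ =>
    gkd (ext2 (γ ∘ Sum.inl) i (γ t)) (ext2 (Function.update (γ ∘ Sum.inr) c j) l s) with hH
  set T : (Fin (2 * m) ⊕ Fin (2 * m) → Fin n) → ℝ := fun γ =>
    Tprod n m R (γ ∘ Sum.inl) (γ ∘ Sum.inr) with hTd
  have main : ∑ γ, H γ * T γ = 0 := by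
    apply sum_cyc_zero H T p q t
    · intro γ
      simp only [hH]
      have e : (γ ∘ swap p q) ∘ Sum.inr = γ ∘ Sum.inr := by
        ext1 x
        simp [swap_apply_of_ne_of_ne, hp, hq]
      rw [e]
      refine gkd_swap _ _ _ a0.castSucc.castSucc a1.castSucc.castSucc (by simpa using h01) ?_
      refine forall_fin2 ?_ ?_ fun x => ?_
      · rw [swap_apply_of_ne_of_ne (cc_ne_last _).symm (cc_ne_last _).symm]
        simp [swap_apply_of_ne_of_ne hpt.symm hqt.symm]
      · rw [swap_apply_of_ne_of_ne (cc_ne_mid _).symm (cc_ne_mid _).symm]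
        simp
      · by_cases x0 : x = a0
        · subst x0; simp [hp, hq]
        by_cases x1 : x = a1
        · subst x1; simp [hp, hq]
        rw [swap_apply_of_ne_of_ne (by simpa using x0) (by simpa using x1)]
        simp [swap_apply_of_ne_of_ne, hp, hq, x0, x1]
    · intro γ
      simp only [hH]
      have e : Function.update ((γ ∘ swap q t) ∘ Sum.inr) c j
          = Function.update (γ ∘ Sum.inr) c j := by
        ext1 x
        by_cases hx : x = c
        · subst hx; simp
        · simp [hx, swap_apply_of_ne_of_ne, hq, ht]
      rw [e]
      refine gkd_swap _ _ _ a1.castSucc.castSucc (Fin.last _) (cc_ne_last _) ?_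
      refine forall_fin2 ?_ ?_ fun x => ?_
      · simp [hq]
      · rw [swap_apply_of_ne_of_ne (cc_ne_mid _).symm mid_ne_last]
        simp
      · by_cases x1 : x = a1
        · subst x1; simp [hq]
        rw [swap_apply_of_ne_of_ne (by simpa using x1) (cc_ne_last _)]
        simp [swap_apply_of_ne_of_ne, hq, ht, x1]
    · intro γ
      have fac : ∀ δ : Fin (2 * m) ⊕ Fin (2 * m) → Fin n,
          (∀ x, x ≠ p → x ≠ q → x ≠ t → δ x = γ x) →
          T δ = R (δ p) (δ q) (δ (Sum.inr a0)) (δ (Sum.inr a1)) *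
            ∏ b ∈ Finset.univ.erase a,
              R (γ (Sum.inl ⟨2 * (b : ℕ), by have := b.isLt; omega⟩))
                (γ (Sum.inl ⟨2 * (b : ℕ) + 1, by have := b.isLt; omega⟩))
                (γ (Sum.inr ⟨2 * (b : ℕ), by have := b.isLt; omega⟩))
                (γ (Sum.inr ⟨2 * (b : ℕ) + 1, by have := b.isLt; omega⟩)) := by
        intro δ hδ
        simp only [hTd, Tprod]
        rw [← Finset.mul_prod_erase Finset.univ _ (Finset.mem_univ a)]
        have ea0 : a0 = ⟨2 * (a : ℕ), by have := a.isLt; omega⟩ := Fin.ext ha0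
        have ea1 : a1 = ⟨2 * (a : ℕ) + 1, by have := a.isLt; omega⟩ := Fin.ext ha1
        congr 1
        · rw [hp, hq, ea0, ea1]; rfl
        · refine Finset.prod_congr rfl fun b hbm => ?_
          have hba : (b : ℕ) ≠ (a : ℕ) := fun h => (Finset.ne_of_mem_erase hbm) (Fin.ext h)
          have hl : ∀ x : Fin (2 * m), (x : ℕ) / 2 = b →
              δ (Sum.inl x) = γ (Sum.inl x) ∧ δ (Sum.inr x) = γ (Sum.inr x) := by
            intro x hx
            have n0 : x ≠ a0 := fun h => by have := congrArg Fin.val h; omega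
            have n1 : x ≠ a1 := fun h => by have := congrArg Fin.val h; omega
            have n2 : x ≠ c := by rcases hc with h | h <;> rw [h] <;> assumption
            exact ⟨hδ _ (by simpa [hp] using n0) (by simpa [hq] using n1) (by simp [ht]),
              hδ _ (by simp [hp]) (by simp [hq]) (by simpa [ht] using n2)⟩
          have b0 := hl ⟨2 * (b : ℕ), by have := b.isLt; omega⟩ (by simp only; omega)
          have b1 := hl ⟨2 * (b : ℕ) + 1, by have := b.isLt; omega⟩ (by simp only; omega)
          simp only [Function.comp]
          rw [b0.1, b0.2, b1.1, b1.2]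
      rw [fac γ (fun _ _ _ _ => rfl),
        fac ((γ ∘ swap p q) ∘ swap q t) (fun x xp xq xt => by
          simp [swap_apply_of_ne_of_ne xq xt, swap_apply_of_ne_of_ne xp xq]),
        fac ((γ ∘ swap q t) ∘ swap p q) (fun x xp xq xt => by
          simp [swap_apply_of_ne_of_ne xq xt, swap_apply_of_ne_of_ne xp xq]),
        ← add_mul, ← add_mul]
      refine mul_eq_zero_of_left ?_ _
      have cyc : ∀ x y z w, R x y z w + R y z x w + R z x y w = 0 := by
        intro x y z w
        have := hb w x y z
        rw [h3 x y z w, h3 y z x w, h3 z x y w, h1 z w, h1 x w, h1 y w]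
        linarith
      have v1 : swap q t p = p := swap_apply_of_ne_of_ne hpq hpt
      have v2 : swap p q t = t := swap_apply_of_ne_of_ne hpt.symm hqt.symm
      rcases hc with h | h
      · have ea : (Sum.inr a0 : Fin (2 * m) ⊕ Fin (2 * m)) = t := by rw [ht, h]
        obtain ⟨y, hy⟩ : ∃ y, y = (Sum.inr a1 : Fin (2 * m) ⊕ Fin (2 * m)) := ⟨_, rfl⟩
        have yp : y ≠ p := by simp [hy, hp]
        have yq : y ≠ q := by simp [hy, hq]
        have yt : y ≠ t := by simpa [hy, ht, h] using h01.symm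
        rw [ea, ← hy]
        simp only [Function.comp, swap_apply_left, swap_apply_right, v1, v2,
          swap_apply_of_ne_of_ne yp yq, swap_apply_of_ne_of_ne yq yt]
        have := cyc (γ p) (γ q) (γ t) (γ y)
        linarith
      · have ea : (Sum.inr a1 : Fin (2 * m) ⊕ Fin (2 * m)) = t := by rw [ht, h]
        obtain ⟨y, hy⟩ : ∃ y, y = (Sum.inr a0 : Fin (2 * m) ⊕ Fin (2 * m)) := ⟨_, rfl⟩
        have yp : y ≠ p := by simp [hy, hp]
        have yq : y ≠ q := by simp [hy, hq]
        have yt : y ≠ t := by simpa [hy, ht, h] using h01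
        rw [ea, ← hy]
        simp only [Function.comp, swap_apply_left, swap_apply_right, v1, v2,
          swap_apply_of_ne_of_ne yp yq, swap_apply_of_ne_of_ne yq yt]
        have := cyc (γ p) (γ q) (γ t) (γ y)
        rw [h2 _ _ (γ y), h2 _ _ (γ y), h2 _ _ (γ y)]
        linarith
  rw [← Fintype.sum_prod_type' (f := fun α β : Fin (2 * m) → Fin n =>
    gkd (ext2 α i (β c)) (ext2 (Function.update β c j) l s) * Tprod n m R α β), ← main]
  exact (Fintype.sum_equiv (Equiv.sumArrowEquivProdArrow _ _ _) _ _ (fun γ => rfl)).symm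

theorem Pk_eq' (n m : ℕ) (R : Fin n → Fin n → Fin n → Fin n → ℝ) (i j l s : Fin n) :
    Pk n m R i j l s = (2 ^ (m + 1) : ℝ)⁻¹ * ∑ α : Fin (2 * m) → Fin n,
      ∑ β : Fin (2 * m) → Fin n,
      gkd (ext2 α i j) (ext2 β l s) * Tprod n m R α β := rfl

theorem Pk_flip1 (n m : ℕ) (R : Fin n → Fin n → Fin n → Fin n → ℝ) (i j l s : Fin n) :
    Pk n m R i j l s = - Pk n m R j i l s := by
  rw [Pk_eq', Pk_eq', ← mul_neg, ← Finset.sum_neg_distrib]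
  congr 1
  refine Finset.sum_congr rfl fun α _ => ?_
  rw [← Finset.sum_neg_distrib]
  refine Finset.sum_congr rfl fun β _ => ?_
  rw [gkd_flip, neg_mul]

theorem Pk_flip2 (n m : ℕ) (R : Fin n → Fin n → Fin n → Fin n → ℝ) (i j l s : Fin n) :
    Pk n m R i j l s = - Pk n m R i j s l := by
  rw [Pk_eq', Pk_eq', ← mul_neg, ← Finset.sum_neg_distrib]
  congr 1
  refine Finset.sum_congr rfl fun α _ => ?_
  rw [← Finset.sum_neg_distrib]
  refine Finset.sum_congr rfl fun β _ => ?_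
  rw [gkd_symm, gkd_flip, neg_mul, gkd_symm]

theorem Pk_pair (n m : ℕ) (R : Fin n → Fin n → Fin n → Fin n → ℝ)
    (h3 : ∀ i j l s, R i j l s = R l s i j) (i j l s : Fin n) :
    Pk n m R i j l s = Pk n m R l s i j := by
  rw [Pk_eq', Pk_eq', Finset.sum_comm]
  congr 1
  refine Finset.sum_congr rfl fun α _ => Finset.sum_congr rfl fun β _ => ?_
  rw [gkd_symm]
  congr 1
  exact Finset.prod_congr rfl fun a _ => h3 _ _ _ _

theorem Pk_bianchi {n m : ℕ} (R : Fin n → Fin n → Fin n → Fin n → ℝ)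
    (h1 : ∀ i j l s, R i j l s = - R j i l s)
    (h2 : ∀ i j l s, R i j l s = - R i j s l)
    (h3 : ∀ i j l s, R i j l s = R l s i j)
    (hb : ∀ i j l s, R i j l s + R i l s j + R i s j l = 0)
    (i j l s : Fin n) :
    Pk n m R i j l s = Pk n m R i l j s + Pk n m R i s l j := by
  rw [Pk_eq', Pk_eq', Pk_eq', ← mul_add]
  congr 1
  simp only [gkd_bianchi _ _ i j l s, add_mul, Finset.sum_add_distrib, Finset.sum_mul]
  have : ∑ α : Fin (2 * m) → Fin n, ∑ β : Fin (2 * m) → Fin n, ∑ c : Fin (2 * m),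
      gkd (ext2 α i (β c)) (ext2 (Function.update β c j) l s) * Tprod n m R α β = 0 := by
    rw [Finset.sum_congr rfl fun α _ => Finset.sum_comm, Finset.sum_comm]
    exact Finset.sum_eq_zero fun c _ => middle_zero R h1 h2 h3 hb i j l s c
  rw [this, zero_add]

/-- `P_{(k)}` has the symmetries of an algebraic curvature tensor:
`P^{ijls} = −P^{jils} = −P^{ijsl} = P^{lsij}`, and it satisfies the first Bianchi-type
identity `P^{ijls} + P^{ilsj} + P^{isjl} = 0`, provided `R` is an algebraic curvature
tensor with the standard symmetries including the first Bianchi identity. -/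
theorem Pk_symmetries {n k : ℕ} (hk : 0 < k) (R : Fin n → Fin n → Fin n → Fin n → ℝ)
    (h1 : ∀ i j l s, R i j l s = - R j i l s)
    (h2 : ∀ i j l s, R i j l s = - R i j s l)
    (h3 : ∀ i j l s, R i j l s = R l s i j)
    (hb : ∀ i j l s, R i j l s + R i l s j + R i s j l = 0)
    (i j l s : Fin n) :
    Pk n (k - 1) R i j l s = - Pk n (k - 1) R j i l s ∧
    Pk n (k - 1) R i j l s = - Pk n (k - 1) R i j s l ∧
    Pk n (k - 1) R i j l s = Pk n (k - 1) R l s i j ∧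
    Pk n (k - 1) R i j l s + Pk n (k - 1) R i l s j + Pk n (k - 1) R i s j l = 0 := by
  refine ⟨Pk_flip1 _ _ _ _ _ _ _, Pk_flip2 _ _ _ _ _ _ _, Pk_pair _ _ _ h3 _ _ _ _, ?_⟩
  have h := Pk_bianchi (m := k - 1) R h1 h2 h3 hb i j l s
  have f1 := Pk_flip2 n (k - 1) R i l s j
  have f2 := Pk_flip2 n (k - 1) R i s j l
  linarith
end

section
/- Chern's transgression identity: on the unit sphere bundle of a Riemannian n-manifold, the forms Φ_k = ε^{α_1...α_{n-1}} Ω_{α_1α_2} ∧ ⋯ ∧ Ω_{α_{2k-1}α_{2k}} ∧ ω_{α_{2k+1} n} ∧ ⋯ ∧ ω_{α_{n-1} n} and Ψ_k = 2(k+1) ε^{α_1...α_{n-1}} Ω_{α_1α_2} ∧ ⋯ ∧ Ω_{α_{2k-1}α_{2k}} ∧ Ω_{α_{2k+1} n} ∧ ω_{α_{2k+2} n} ∧ ⋯ ∧ ω_{α_{n-1} n} satisfy dΦ_k = Ψ_{k−1} + ((n−2k−1)/(2(k+1))) Ψ_k for k = 0,1,...,⌊n/2⌋−1. -/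
noncomputable section

/-- The base chart of the manifold. -/
abbrev Euc (n : ℕ) := EuclideanSpace ℝ (Fin n)

/-- A differential `p`-form, represented by its coefficient functions in coordinates. -/
abbrev Form (n p : ℕ) := Euc n → (Fin p → Fin n) → ℝ

/-- Partial derivative in the `i`-th coordinate direction. -/
def pder {n : ℕ} (i : Fin n) (f : Euc n → ℝ) (x : Euc n) : ℝ :=
  fderiv ℝ f x (EuclideanSpace.single i 1)

/-- Wedge product. -/
def wedge {n p q : ℕ} (a : Form n p) (b : Form n q) : Form n (p + q) :=
  fun x v => ((p.factorial * q.factorial : ℕ) : ℝ)⁻¹ * ∑ σ : Equiv.Perm (Fin (p + q)),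
    ((Equiv.Perm.sign σ : ℤ) : ℝ)
      * a x (fun i => v (σ (Fin.castAdd q i)))
      * b x (fun i => v (σ (Fin.natAdd p i)))

/-- Exterior derivative, componentwise. -/
def extd {n p : ℕ} (a : Form n p) : Form n (p + 1) :=
  fun x v => ∑ i : Fin (p + 1),
    (-1 : ℝ) ^ (i : ℕ) * pder (v i) (fun y => a y (v ∘ i.succAbove)) x

/-- Chern's transgression form
`Φ_k = ε^{α_1...α_{n-1}} Ω_{α_1α_2} ∧ ⋯ ∧ Ω_{α_{2k-1}α_{2k}} ∧ ω_{α_{2k+1} n} ∧ ⋯ ∧ ω_{α_{n-1} n}`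
(here `n = m + 1` and the index `n` is `Fin.last m`), written out in components:
the `ε` sum is a signed sum over permutations `τ` of `{1, ..., n-1}` and the wedge
product of the `k` curvature 2-forms and `n-1-2k` connection 1-forms is the signed sum
over permutations `σ` of the `n-1` slots with normalization `2^{-k}`. -/
def Phi (m k : ℕ) (Ω : Fin (m + 1) → Fin (m + 1) → Form (m + 1) 2)
    (ωc : Fin (m + 1) → Fin (m + 1) → Form (m + 1) 1) : Form (m + 1) m :=
  if h : 2 * k ≤ m then
    fun x v => (2 ^ k : ℝ)⁻¹ *
      ∑ τ : Equiv.Perm (Fin m), ∑ σ : Equiv.Perm (Fin m),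
        ((Equiv.Perm.sign τ : ℤ) : ℝ) * ((Equiv.Perm.sign σ : ℤ) : ℝ)
        * (∏ a : Fin k,
            Ω (Fin.castSucc (τ ⟨2 * (a : ℕ), by have := a.isLt; omega⟩))
              (Fin.castSucc (τ ⟨2 * (a : ℕ) + 1, by have := a.isLt; omega⟩)) x
              ![v (σ ⟨2 * (a : ℕ), by have := a.isLt; omega⟩),
                v (σ ⟨2 * (a : ℕ) + 1, by have := a.isLt; omega⟩)])
        * (∏ b : Fin (m - 2 * k),
            ωc (Fin.castSucc (τ ⟨2 * k + (b : ℕ), by have := b.isLt; omega⟩))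
              (Fin.last m) x
              ![v (σ ⟨2 * k + (b : ℕ), by have := b.isLt; omega⟩)])
  else 0

/-- Chern's form
`Ψ_k = 2(k+1) ε^{α_1...α_{n-1}} Ω_{α_1α_2} ∧ ⋯ ∧ Ω_{α_{2k-1}α_{2k}} ∧ Ω_{α_{2k+1} n} ∧ ω_{α_{2k+2} n} ∧ ⋯ ∧ ω_{α_{n-1} n}`
written out in components (`n = m + 1`). -/
def Psi (m k : ℕ) (Ω : Fin (m + 1) → Fin (m + 1) → Form (m + 1) 2)
    (ωc : Fin (m + 1) → Fin (m + 1) → Form (m + 1) 1) : Form (m + 1) (m + 1) :=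
  if h : 2 * k + 1 ≤ m then
    fun x v => (2 * ((k : ℝ) + 1)) * (2 ^ (k + 1) : ℝ)⁻¹ *
      ∑ τ : Equiv.Perm (Fin m), ∑ σ : Equiv.Perm (Fin (m + 1)),
        ((Equiv.Perm.sign τ : ℤ) : ℝ) * ((Equiv.Perm.sign σ : ℤ) : ℝ)
        * (∏ a : Fin k,
            Ω (Fin.castSucc (τ ⟨2 * (a : ℕ), by have := a.isLt; omega⟩))
              (Fin.castSucc (τ ⟨2 * (a : ℕ) + 1, by have := a.isLt; omega⟩)) x
              ![v (σ ⟨2 * (a : ℕ), by have := a.isLt; omega⟩),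
                v (σ ⟨2 * (a : ℕ) + 1, by have := a.isLt; omega⟩)])
        * Ω (Fin.castSucc (τ ⟨2 * k, by omega⟩)) (Fin.last m) x
            ![v (σ ⟨2 * k, by omega⟩), v (σ ⟨2 * k + 1, by omega⟩)]
        * (∏ b : Fin (m - 2 * k - 1),
            ωc (Fin.castSucc (τ ⟨2 * k + 1 + (b : ℕ), by have := b.isLt; omega⟩))
              (Fin.last m) x
              ![v (σ ⟨2 * k + 2 + (b : ℕ), by have := b.isLt; omega⟩)])
  else 0

section ChernAux

open Equiv Finset

/-- real-valued sign -/
def sg {N : ℕ} (σ : Perm (Fin N)) : ℝ := ((Perm.sign σ : ℤ) : ℝ)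

lemma sg_mul {N : ℕ} (σ ρ : Perm (Fin N)) : sg (σ * ρ) = sg σ * sg ρ := by
  simp [sg]

lemma sg_swap {N : ℕ} {a b : Fin N} (h : a ≠ b) : sg (swap a b) = -1 := by
  simp [sg, Perm.sign_swap h]

lemma sg_sq {N : ℕ} (σ : Perm (Fin N)) : sg σ * sg σ = 1 := by
  rcases Int.units_eq_one_or (Perm.sign σ) with h | h <;> simp [sg, h]

lemma alt_reindex {N : ℕ} (G : (Perm (Fin N)) → ℝ) (c : Perm (Fin N)) :
    ∑ σ : Perm (Fin N), sg σ * G σ = sg c * ∑ σ : Perm (Fin N), sg σ * G (σ * c) := by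
  rw [← Equiv.sum_comp (Equiv.mulRight c) (fun σ => sg σ * G σ), Finset.mul_sum]
  refine Finset.sum_congr rfl fun σ _ => ?_
  simp only [Equiv.coe_mulRight, sg_mul]; ring

lemma alt2 {N : ℕ} {ι : Type*} (Y : ι → ι → ℝ) (R : (Fin N → ι) → ℝ) (v : Fin N → ι) (p q : Fin N)
    (hpq : p ≠ q) (hY : ∀ i j, Y i j = Y j i)
    (hR : ∀ u u' : Fin N → ι, (∀ s, s ≠ p → s ≠ q → u s = u' s) → R u = R u') :
    ∑ σ : Perm (Fin N), sg σ * (Y (v (σ p)) (v (σ q)) * R (fun s => v (σ s))) = 0 := by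
  have h := alt_reindex (fun σ : Perm (Fin N) => Y (v (σ p)) (v (σ q)) * R (fun s => v (σ s)))
    (swap p q)
  rw [sg_swap hpq] at h
  have e : ∀ σ : Perm (Fin N), Y (v ((σ * swap p q) p)) (v ((σ * swap p q) q)) *
      R (fun s => v ((σ * swap p q) s)) = Y (v (σ p)) (v (σ q)) * R (fun s => v (σ s)) := by
    intro σ
    rw [hR (fun s => v ((σ * swap p q) s)) (fun s => v (σ s))]
    · simp [hY (v (σ q))]
    · intro s h1 h2; simp [swap_apply_of_ne_of_ne h1 h2]
  simp only [e] at h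
  linarith

lemma alt3 {N : ℕ} {ι : Type*} (Y : ι → ι → ι → ℝ) (R : (Fin N → ι) → ℝ) (v : Fin N → ι)
    (p q r : Fin N)
    (hpq : p ≠ q) (hpr : p ≠ r) (hqr : q ≠ r)
    (hY : ∀ i j l, Y i j l + Y j l i + Y l i j = 0)
    (hR : ∀ u u' : Fin N → ι, (∀ s, s ≠ p → s ≠ q → s ≠ r → u s = u' s) → R u = R u') :
    ∑ σ : Perm (Fin N), sg σ * (Y (v (σ p)) (v (σ q)) (v (σ r)) * R (fun s => v (σ s))) = 0 := by
  set c : Perm (Fin N) := swap p q * swap q r with hc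
  have hsg : sg c = 1 := by rw [hc, sg_mul, sg_swap hpq, sg_swap hqr]; norm_num
  have c1 : c p = q := by simp [hc, swap_apply_of_ne_of_ne hpq hpr]
  have c2 : c q = r := by simp [hc, swap_apply_of_ne_of_ne hpr.symm hqr.symm]
  have c3 : c r = p := by simp [hc]
  have c4 : ∀ s, s ≠ p → s ≠ q → s ≠ r → c s = s := by
    intro s h1 h2 h3
    simp [hc, swap_apply_of_ne_of_ne h1 h2, swap_apply_of_ne_of_ne h2 h3]
  have key : ∀ Y : ι → ι → ι → ℝ,
      ∑ σ : Perm (Fin N), sg σ * (Y (v (σ p)) (v (σ q)) (v (σ r)) * R (fun s => v (σ s))) =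
      ∑ σ : Perm (Fin N), sg σ * (Y (v (σ q)) (v (σ r)) (v (σ p)) * R (fun s => v (σ s))) := by
    intro Y
    rw [alt_reindex (fun σ : Perm (Fin N) =>
      Y (v (σ p)) (v (σ q)) (v (σ r)) * R (fun s => v (σ s))) c, hsg, one_mul]
    refine Finset.sum_congr rfl fun σ _ => ?_
    simp only [Perm.mul_apply, c1, c2, c3]
    rw [hR (fun s => v (σ (c s))) (fun s => v (σ s))]
    intro s h1 h2 h3
    simp only [c4 s h1 h2 h3]
  have k1 := key Y
  have k2 := key (fun i j l => Y j l i)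
  have s0 : ∑ σ : Perm (Fin N), sg σ * (Y (v (σ p)) (v (σ q)) (v (σ r)) * R (fun s => v (σ s)))
    + ∑ σ : Perm (Fin N), sg σ * (Y (v (σ q)) (v (σ r)) (v (σ p)) * R (fun s => v (σ s)))
    + ∑ σ : Perm (Fin N), sg σ * (Y (v (σ r)) (v (σ p)) (v (σ q)) * R (fun s => v (σ s))) = 0 := by
    rw [← Finset.sum_add_distrib, ← Finset.sum_add_distrib]
    refine Finset.sum_eq_zero fun σ _ => ?_
    have := hY (v (σ p)) (v (σ q)) (v (σ r))
    linear_combination (sg σ * R (fun s => v (σ s))) * this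
  linarith

/-- trace cancellation -/
lemma trace_cancel {m : ℕ} (M : Fin m → Fin m → ℝ) (hM : ∀ a, M a a = 0)
    (F : (Fin m → Fin m) → ℝ) :
    ∑ τ : Perm (Fin m), sg τ * ∑ p, ∑ g, M (τ p) g * F (Function.update τ p g) = 0 := by
  have e : ∀ τ : Perm (Fin m), ∑ p, ∑ g, M (τ p) g * F (Function.update τ p g)
      = ∑ p, ∑ q, M (τ p) (τ q) * F (Function.update τ p (τ q)) := by
    intro τ
    refine Finset.sum_congr rfl fun p _ => ?_
    exact (Equiv.sum_comp τ (fun g => M (τ p) g * F (Function.update τ p g))).symm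
  simp only [e, Finset.mul_sum]
  rw [Finset.sum_comm]
  refine (Finset.sum_congr rfl fun p _ => Finset.sum_comm).trans ?_
  have hpq : ∀ p q : Fin m, ∑ τ : Perm (Fin m),
      sg τ * (M (τ p) (τ q) * F (Function.update τ p (τ q))) =
      - ∑ τ : Perm (Fin m), sg τ * (M (τ q) (τ p) * F (Function.update τ q (τ p))) := by
    intro p q
    by_cases h : p = q
    · subst h; simp [hM]
    · rw [alt_reindex _ (swap p q), sg_swap h, neg_one_mul]
      congr 1
      refine Finset.sum_congr rfl fun τ _ => ?_
      simp only [Perm.mul_apply, swap_apply_left, swap_apply_right]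
      congr 3
      funext s
      by_cases h1 : s = p
      · subst h1; simp [Function.update_of_ne h]
      · by_cases h2 : s = q
        · subst h2; simp [Function.update_of_ne h1]
        · simp [Function.update_of_ne h1, Function.update_of_ne h2, swap_apply_of_ne_of_ne h1 h2]
  have : ∀ S : ℝ, S = -S → S = 0 := fun S h => by linarith
  apply this
  conv_rhs => rw [Finset.sum_comm]
  rw [← Finset.sum_neg_distrib]
  refine Finset.sum_congr rfl fun p _ => ?_
  rw [← Finset.sum_neg_distrib]
  refine Finset.sum_congr rfl fun q _ => ?_
  exact hpq p q

/-- lift of a permutation of slots, fixing `0` -/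
def lft {m : ℕ} (π : Perm (Fin m)) : Perm (Fin (m + 1)) := Equiv.Perm.decomposeFin.symm (0, π)

lemma lft_zero {m : ℕ} (π : Perm (Fin m)) : lft π 0 = 0 := by simp [lft]
lemma lft_succ {m : ℕ} (π : Perm (Fin m)) (s : Fin m) : lft π s.succ = (π s).succ := by
  simp [lft]
lemma sg_lft {m : ℕ} (π : Perm (Fin m)) : sg (lft π) = sg π := by
  simp [lft, sg]

lemma reindex_pi {m : ℕ} {ι : Type*} (G : (Fin m → Fin m) → (Fin (m+1) → ι) → ℝ)
    (v : Fin (m + 1) → ι) (π : Perm (Fin m)) :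
    ∑ τ : Perm (Fin m), sg τ * ∑ σ : Perm (Fin (m + 1)), sg σ * G τ (fun s => v (σ s)) =
    ∑ τ : Perm (Fin m), sg τ * ∑ σ : Perm (Fin (m + 1)), sg σ *
      G (fun s => τ (π s)) (fun s => v (σ (lft π s))) := by
  rw [alt_reindex (fun τ : Perm (Fin m) =>
    ∑ σ : Perm (Fin (m + 1)), sg σ * G τ (fun s => v (σ s))) π, Finset.mul_sum]
  refine Finset.sum_congr rfl fun τ _ => ?_
  rw [alt_reindex (fun σ : Perm (Fin (m + 1)) => G (τ * π : Perm (Fin m)) (fun s => v (σ s))) (lft π),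
    sg_lft]
  have := sg_sq π
  have e : ((τ * π : Perm (Fin m)) : Fin m → Fin m) = fun s => τ (π s) := rfl
  rw [e]
  simp only [Perm.mul_apply]
  linear_combination (sg τ * ∑ σ : Perm (Fin (m + 1)), sg σ *
      G (fun s => τ (π s)) (fun s => v (σ (lft π s)))) * this

lemma extd_reindex {m : ℕ} (H : Perm (Fin (m + 1)) → ℝ) :
    ∑ i : Fin (m + 1), ∑ σ : Perm (Fin m), (-1 : ℝ) ^ (i : ℕ) * sg σ *
      H (i.cycleRange.symm * lft σ) = ∑ ρ : Perm (Fin (m + 1)), sg ρ * H ρ := by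
  rw [← Fintype.sum_prod_type' (f := fun (i : Fin (m+1)) (σ : Perm (Fin m)) =>
    (-1 : ℝ) ^ (i : ℕ) * sg σ * H (i.cycleRange.symm * lft σ))]
  refine Fintype.sum_bijective
    (fun x : Fin (m + 1) × Perm (Fin m) => (x.1.cycleRange.symm * lft x.2 : Perm (Fin (m+1)))) ?_ _ _ ?_
  · rw [Fintype.bijective_iff_injective_and_card]
    constructor
    · rintro ⟨i, σ⟩ ⟨j, ρ⟩ h
      simp only at h
      have h0 : i = j := by
        have := congrArg (fun f : Perm (Fin (m+1)) => f 0) h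
        simpa [lft_zero] using this
      subst h0
      have := mul_left_cancel h
      have := Equiv.Perm.decomposeFin.symm.injective this
      simpa using this
    · simp [Fintype.card_perm, Nat.factorial_succ]
  · rintro ⟨i, σ⟩
    simp only [sg_mul, sg_lft]
    congr 2
    simp [sg, Fin.sign_cycleRange]

lemma ext_slots {m : ℕ} (i : Fin (m + 1)) (σ : Perm (Fin m)) (s : Fin m) :
    (i.cycleRange.symm * lft σ : Perm (Fin (m+1))) s.succ = i.succAbove (σ s) := by
  simp [lft_succ]
lemma ext_zero {m : ℕ} (i : Fin (m + 1)) (σ : Perm (Fin m)) :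
    (i.cycleRange.symm * lft σ : Perm (Fin (m+1))) 0 = i := by
  simp [lft_zero]

def sA {m k : ℕ} (h : 2 * k ≤ m) (a : Fin k) : Fin m := ⟨2 * a, by have := a.isLt; omega⟩
def sA' {m k : ℕ} (h : 2 * k ≤ m) (a : Fin k) : Fin m := ⟨2 * a + 1, by have := a.isLt; omega⟩
def sB {m k : ℕ} (h : 2 * k ≤ m) (b : Fin (m - 2 * k)) : Fin m :=
  ⟨2 * k + b, by have := b.isLt; omega⟩

lemma sA_inj {m k : ℕ} (h : 2 * k ≤ m) {a b : Fin k} : sA h a = sA h b ↔ a = b := by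
  simp only [sA, Fin.ext_iff]; omega
lemma sA'_inj {m k : ℕ} (h : 2 * k ≤ m) {a b : Fin k} : sA' h a = sA' h b ↔ a = b := by
  simp only [sA', Fin.ext_iff]; omega
lemma sB_inj {m k : ℕ} (h : 2 * k ≤ m) {a b : Fin (m - 2 * k)} : sB h a = sB h b ↔ a = b := by
  simp only [sB, Fin.ext_iff]; omega
lemma sA_ne_sA' {m k : ℕ} (h : 2 * k ≤ m) (a b : Fin k) : sA h a ≠ sA' h b := by
  simp only [sA, sA', ne_eq, Fin.ext_iff]; omega
lemma sA_ne_sB {m k : ℕ} (h : 2 * k ≤ m) (a : Fin k) (b : Fin (m - 2 * k)) :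
    sA h a ≠ sB h b := by
  have := a.isLt
  simp only [sA, sB, ne_eq, Fin.ext_iff]; omega
lemma sA'_ne_sB {m k : ℕ} (h : 2 * k ≤ m) (a : Fin k) (b : Fin (m - 2 * k)) :
    sA' h a ≠ sB h b := by
  have := a.isLt
  simp only [sA', sB, ne_eq, Fin.ext_iff]; omega

lemma sum_pairs (g : ℕ → ℝ) (k : ℕ) :
    ∑ i ∈ range (2 * k), g i = ∑ a ∈ range k, (g (2 * a) + g (2 * a + 1)) := by
  induction k with
  | zero => simp
  | succ k ih =>
    rw [show 2 * (k + 1) = 2 * k + 1 + 1 by ring, sum_range_succ, sum_range_succ, ih,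
      sum_range_succ]; ring

lemma sum_slots {m k : ℕ} (h : 2 * k ≤ m) (g : Fin m → ℝ) :
    ∑ p, g p = ∑ a : Fin k, (g (sA h a) + g (sA' h a)) + ∑ b, g (sB h b) := by
  set G : ℕ → ℝ := fun i => if hi : i < m then g ⟨i, hi⟩ else 0 with hG
  have e1 : ∑ p, g p = ∑ i ∈ range m, G i := by
    rw [Finset.sum_range]
    refine Finset.sum_congr rfl fun p _ => ?_
    simp [hG]
  have e2 : ∑ a : Fin k, (g (sA h a) + g (sA' h a)) = ∑ a ∈ range k, (G (2 * a) + G (2 * a + 1)) := by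
    rw [Finset.sum_range]
    refine Finset.sum_congr rfl fun a _ => ?_
    have := a.isLt
    simp only [hG]
    rw [dif_pos (by omega), dif_pos (by omega)]; rfl
  have e3 : ∑ b, g (sB h b) = ∑ b ∈ range (m - 2 * k), G (2 * k + b) := by
    rw [Finset.sum_range]
    refine Finset.sum_congr rfl fun a _ => ?_
    have := a.isLt
    simp only [hG]
    rw [dif_pos (by omega)]; rfl
  rw [e1, e2, e3, ← sum_pairs, ← Finset.sum_range_add]
  congr 2; omega

abbrev Mt (m : ℕ) := Matrix (Fin (m + 1)) (Fin (m + 1)) ℝ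

def fO {m k : ℕ} (h : 2 * k ≤ m) (O : Fin (m + 1) → Fin (m + 1) → Mt m)
    (f : Fin m → Fin m) (u : Fin (m + 1) → Fin (m + 1)) (a : Fin k) : ℝ :=
  O (u (sA h a).succ) (u (sA' h a).succ) (f (sA h a)).castSucc (f (sA' h a)).castSucc

def fW {m k : ℕ} (h : 2 * k ≤ m) (W : Fin (m + 1) → Mt m)
    (f : Fin m → Fin m) (u : Fin (m + 1) → Fin (m + 1)) (b : Fin (m - 2 * k)) : ℝ :=
  W (u (sB h b).succ) (f (sB h b)).castSucc (Fin.last m)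

def RO {m k : ℕ} (h : 2 * k ≤ m) (W : Fin (m + 1) → Mt m)
    (O : Fin (m + 1) → Fin (m + 1) → Mt m)
    (f : Fin m → Fin m) (u : Fin (m + 1) → Fin (m + 1)) (a : Fin k) : ℝ :=
  (∏ a' ∈ univ.erase a, fO h O f u a') * ∏ b, fW h W f u b

def RB {m k : ℕ} (h : 2 * k ≤ m) (W : Fin (m + 1) → Mt m)
    (O : Fin (m + 1) → Fin (m + 1) → Mt m)
    (f : Fin m → Fin m) (u : Fin (m + 1) → Fin (m + 1)) (b : Fin (m - 2 * k)) : ℝ :=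
  (∏ a', fO h O f u a') * ∏ b' ∈ univ.erase b, fW h W f u b'

/-- the Leibniz expression -/
def LL {m k : ℕ} (h : 2 * k ≤ m) (W : Fin (m + 1) → Mt m)
    (O D : Fin (m + 1) → Fin (m + 1) → Mt m) (P : Fin (m + 1) → Fin (m + 1) → Fin (m + 1) → Mt m)
    (f : Fin m → Fin m) (u : Fin (m + 1) → Fin (m + 1)) : ℝ :=
  (∑ a : Fin k, P (u 0) (u (sA h a).succ) (u (sA' h a).succ) (f (sA h a)).castSucc
      (f (sA' h a)).castSucc * RO h W O f u a) +
  ∑ b, D (u 0) (u (sB h b).succ) (f (sB h b)).castSucc (Fin.last m) * RB h W O f u b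

/-- first contribution -/
def TA {m k : ℕ} (h : 2 * k ≤ m) (W : Fin (m + 1) → Mt m)
    (O : Fin (m + 1) → Fin (m + 1) → Mt m) (a : Fin k)
    (f : Fin m → Fin m) (u : Fin (m + 1) → Fin (m + 1)) : ℝ :=
  W (u 0) (f (sA' h a)).castSucc (Fin.last m) *
    O (u (sA h a).succ) (u (sA' h a).succ) (f (sA h a)).castSucc (Fin.last m) * RO h W O f u a

def TA' {m k : ℕ} (h : 2 * k ≤ m) (W : Fin (m + 1) → Mt m)
    (O : Fin (m + 1) → Fin (m + 1) → Mt m) (a : Fin k)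
    (f : Fin m → Fin m) (u : Fin (m + 1) → Fin (m + 1)) : ℝ :=
  W (u 0) (f (sA h a)).castSucc (Fin.last m) *
    O (u (sA h a).succ) (u (sA' h a).succ) (Fin.last m) (f (sA' h a)).castSucc * RO h W O f u a

def TB {m k : ℕ} (h : 2 * k ≤ m) (W : Fin (m + 1) → Mt m)
    (O : Fin (m + 1) → Fin (m + 1) → Mt m) (b : Fin (m - 2 * k))
    (f : Fin m → Fin m) (u : Fin (m + 1) → Fin (m + 1)) : ℝ :=
  O (u 0) (u (sB h b).succ) (f (sB h b)).castSucc (Fin.last m) * RB h W O f u b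

def FF {m k : ℕ} (h : 2 * k ≤ m) (W : Fin (m + 1) → Mt m)
    (O : Fin (m + 1) → Fin (m + 1) → Mt m)
    (u : Fin (m + 1) → Fin (m + 1)) (f : Fin m → Fin m) : ℝ :=
  (∏ a', fO h O f u a') * ∏ b', fW h W f u b'

lemma FF_update_A {m k : ℕ} (h : 2 * k ≤ m) (W : Fin (m + 1) → Mt m)
    (O : Fin (m + 1) → Fin (m + 1) → Mt m)
    (u : Fin (m + 1) → Fin (m + 1)) (f : Fin m → Fin m) (a : Fin k) (g : Fin m) :
    FF h W O u (Function.update f (sA h a) g) =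
      O (u (sA h a).succ) (u (sA' h a).succ) g.castSucc (f (sA' h a)).castSucc *
        RO h W O f u a := by
  rw [FF, RO, ← Finset.mul_prod_erase univ _ (Finset.mem_univ a), mul_assoc]
  congr 1
  · simp [fO, (sA_ne_sA' h _ _).symm]
  · congr 1
    · refine Finset.prod_congr rfl fun a' ha' => ?_
      have : a' ≠ a := (Finset.mem_erase.mp ha').1
      simp [fO, (sA_ne_sA' h _ _).symm, sA_inj, this, Function.update_of_ne]
    · refine Finset.prod_congr rfl fun b _ => ?_
      simp [fW, (sA_ne_sB h _ _).symm]

lemma FF_update_A' {m k : ℕ} (h : 2 * k ≤ m) (W : Fin (m + 1) → Mt m)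
    (O : Fin (m + 1) → Fin (m + 1) → Mt m)
    (u : Fin (m + 1) → Fin (m + 1)) (f : Fin m → Fin m) (a : Fin k) (g : Fin m) :
    FF h W O u (Function.update f (sA' h a) g) =
      O (u (sA h a).succ) (u (sA' h a).succ) (f (sA h a)).castSucc g.castSucc *
        RO h W O f u a := by
  rw [FF, RO, ← Finset.mul_prod_erase univ _ (Finset.mem_univ a), mul_assoc]
  congr 1
  · simp [fO, (sA_ne_sA' h _ _)]
  · congr 1
    · refine Finset.prod_congr rfl fun a' ha' => ?_
      have : a' ≠ a := (Finset.mem_erase.mp ha').1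
      simp [fO, (sA_ne_sA' h _ _), sA'_inj, this, Function.update_of_ne]
    · refine Finset.prod_congr rfl fun b _ => ?_
      simp [fW, (sA'_ne_sB h _ _).symm]

lemma FF_update_B {m k : ℕ} (h : 2 * k ≤ m) (W : Fin (m + 1) → Mt m)
    (O : Fin (m + 1) → Fin (m + 1) → Mt m)
    (u : Fin (m + 1) → Fin (m + 1)) (f : Fin m → Fin m) (b : Fin (m - 2 * k)) (g : Fin m) :
    FF h W O u (Function.update f (sB h b) g) =
      W (u (sB h b).succ) g.castSucc (Fin.last m) * RB h W O f u b := by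
  rw [FF, RB, ← Finset.mul_prod_erase univ (fW h W _ u) (Finset.mem_univ b)]
  rw [mul_left_comm]
  congr 1
  · simp [fW]
  · congr 1
    · refine Finset.prod_congr rfl fun a' ha' => ?_
      simp [fO, sA_ne_sB, sA'_ne_sB, Function.update_of_ne]
    · refine Finset.prod_congr rfl fun b' hb' => ?_
      have : b' ≠ b := (Finset.mem_erase.mp hb').1
      simp [fW, sB_inj, this, Function.update_of_ne]

/-- expression after Bianchi and structure equation -/
def LB {m k : ℕ} (h : 2 * k ≤ m) (W : Fin (m + 1) → Mt m)
    (O : Fin (m + 1) → Fin (m + 1) → Mt m)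
    (f : Fin m → Fin m) (u : Fin (m + 1) → Fin (m + 1)) : ℝ :=
  (∑ a : Fin k, (∑ g, (W (u 0) (f (sA h a)).castSucc g *
        O (u (sA h a).succ) (u (sA' h a).succ) g (f (sA' h a)).castSucc +
      W (u 0) (f (sA' h a)).castSucc g *
        O (u (sA h a).succ) (u (sA' h a).succ) (f (sA h a)).castSucc g)) * RO h W O f u a) +
  ∑ b, (1 / 2 * O (u 0) (u (sB h b).succ) (f (sB h b)).castSucc (Fin.last m) +
    ∑ g, W (u 0) (f (sB h b)).castSucc g * W (u (sB h b).succ) g (Fin.last m)) * RB h W O f u b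

lemma LB_eq {m k : ℕ} (h : 2 * k ≤ m) (W : Fin (m + 1) → Mt m)
    (O : Fin (m + 1) → Fin (m + 1) → Mt m) (hW : ∀ i, W i (Fin.last m) (Fin.last m) = 0)
    (f : Fin m → Fin m) (u : Fin (m + 1) → Fin (m + 1)) :
    LB h W O f u = (∑ p, ∑ g : Fin m, W (u 0) (f p).castSucc g.castSucc *
        FF h W O u (Function.update f p g)) +
      (∑ a, (TA h W O a f u + TA' h W O a f u)) + 1 / 2 * ∑ b, TB h W O b f u := by
  rw [sum_slots h, LB, Finset.mul_sum, add_assoc, add_add_add_comm, ← Finset.sum_add_distrib,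
    ← Finset.sum_add_distrib]
  congr 1
  · refine Finset.sum_congr rfl fun a _ => ?_
    simp only [FF_update_A, FF_update_A', TA, TA', Fin.sum_univ_castSucc]
    simp only [← mul_assoc, ← Finset.sum_mul, Finset.sum_add_distrib]
    ring
  · refine Finset.sum_congr rfl fun b _ => ?_
    simp only [FF_update_B, TB, Fin.sum_univ_castSucc, hW]
    simp only [← mul_assoc, ← Finset.sum_mul]
    ring

lemma LL_LB {m k : ℕ} (h : 2 * k ≤ m) (W : Fin (m + 1) → Mt m)
    (O D : Fin (m + 1) → Fin (m + 1) → Mt m) (P : Fin (m + 1) → Fin (m + 1) → Fin (m + 1) → Mt m)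
    (hO : ∀ i j, O i j = D i j - D j i - (W i * W j - W j * W i))
    (hWa : ∀ i α β, W i α β = - W i β α)
    (hP : ∀ i j l, P i j l + P j l i + P l i j =
      (W i * O j l - O j l * W i) + (W j * O l i - O l i * W j) + (W l * O i j - O i j * W l))
    (f : Fin m → Fin m) (v : Fin (m + 1) → Fin (m + 1)) :
    ∑ σ : Perm (Fin (m + 1)), sg σ * LL h W O D P f (fun s => v (σ s)) =
    ∑ σ : Perm (Fin (m + 1)), sg σ * LB h W O f (fun s => v (σ s)) := by
  rw [← sub_eq_zero, ← Finset.sum_sub_distrib]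
  simp only [LL, LB, ← mul_sub]
  simp only [add_sub_add_comm, ← Finset.sum_sub_distrib, ← sub_mul]
  simp only [mul_add, Finset.sum_add_distrib, Finset.mul_sum]
  rw [Finset.sum_comm]
  conv_lhs => arg 2; rw [Finset.sum_comm]
  rw [Finset.sum_eq_zero, Finset.sum_eq_zero, add_zero]
  · intro b _
    refine alt2 (fun i j => D i j (f (sB h b)).castSucc (Fin.last m) -
      (1 / 2 * O i j (f (sB h b)).castSucc (Fin.last m) +
        ∑ g, W i (f (sB h b)).castSucc g * W j g (Fin.last m))) (fun u => RB h W O f u b) v 0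
        (sB h b).succ (Fin.succ_ne_zero _).symm ?_ ?_
    · intro i j
      simp only [hO, Matrix.sub_apply, Matrix.mul_apply]
      ring
    · intro u u' huu
      simp only [RB]
      congr 1
      · refine Finset.prod_congr rfl fun a _ => ?_
        simp only [fO]
        rw [huu _ (Fin.succ_ne_zero _) (by simp [sA_ne_sB]),
          huu _ (Fin.succ_ne_zero _) (by simp [sA'_ne_sB])]
      · refine Finset.prod_congr rfl fun b' hb' => ?_
        have : b' ≠ b := (Finset.mem_erase.mp hb').1
        simp only [fW]
        rw [huu _ (Fin.succ_ne_zero _) (by simpa [sB_inj] using this)]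
  · intro a _
    refine alt3 (fun l i j => P l i j (f (sA h a)).castSucc (f (sA' h a)).castSucc -
      (∑ g, W l (f (sA h a)).castSucc g * O i j g (f (sA' h a)).castSucc +
       ∑ g, W l (f (sA' h a)).castSucc g * O i j (f (sA h a)).castSucc g))
        (fun u => RO h W O f u a) v 0
        (sA h a).succ (sA' h a).succ (Fin.succ_ne_zero _).symm (Fin.succ_ne_zero _).symm
        (by simp [sA_ne_sA']) ?_ ?_
    · intro i j l
      have e : ∀ i j l α β, ∑ g, W l α g * O i j g β + ∑ g, W l β g * O i j α g =
          (W l * O i j - O i j * W l) α β := by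
        intro i j l α β
        rw [Matrix.sub_apply, Matrix.mul_apply, Matrix.mul_apply, sub_eq_add_neg,
          ← Finset.sum_neg_distrib]
        congr 1
        refine Finset.sum_congr rfl fun g _ => ?_
        rw [hWa l β g]; ring
      have hp := congrFun (congrFun (hP i j l) (f (sA h a)).castSucc) (f (sA' h a)).castSucc
      simp only [e]
      simp only [Matrix.add_apply] at hp
      linarith
    · intro u u' huu
      simp only [RO]
      congr 1
      · refine Finset.prod_congr rfl fun a' ha' => ?_
        have : a' ≠ a := (Finset.mem_erase.mp ha').1
        simp only [fO]
        rw [huu _ (Fin.succ_ne_zero _) (by simpa [sA_inj] using this) (by simp [sA_ne_sA']),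
          huu _ (Fin.succ_ne_zero _) (by simp [(sA_ne_sA' h _ _).symm])
            (by simpa [sA'_inj] using this)]
      · refine Finset.prod_congr rfl fun b' hb' => ?_
        simp only [fW]
        rw [huu _ (Fin.succ_ne_zero _) (by simp [(sA_ne_sB h _ _).symm])
            (by simp [(sA'_ne_sB h _ _).symm])]

/-- double alternation -/
def AA {m : ℕ} (v : Fin (m + 1) → Fin (m + 1))
    (G : (Fin m → Fin m) → (Fin (m+1) → Fin (m + 1)) → ℝ) : ℝ :=
  ∑ τ : Perm (Fin m), sg τ * ∑ σ : Perm (Fin (m + 1)), sg σ * G τ (fun s => v (σ s))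

lemma AA_add {m : ℕ} (v : Fin (m + 1) → Fin (m + 1)) (G H) :
    AA v (fun f u => G f u + H f u) = AA v G + AA v H := by
  simp only [AA, mul_add, Finset.sum_add_distrib]

lemma AA_smul {m : ℕ} (v : Fin (m + 1) → Fin (m + 1)) (c : ℝ) (G) :
    AA v (fun f u => c * G f u) = c * AA v G := by
  simp only [AA, Finset.mul_sum]
  refine Finset.sum_congr rfl fun _ _ => Finset.sum_congr rfl fun _ _ => by ring

lemma AA_sum {m : ℕ} {ι : Type*} [Fintype ι] (v : Fin (m + 1) → Fin (m + 1))
    (G : ι → (Fin m → Fin m) → (Fin (m+1) → Fin (m + 1)) → ℝ) :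
    AA v (fun f u => ∑ i, G i f u) = ∑ i, AA v (G i) := by
  simp only [AA, Finset.mul_sum]
  refine (Finset.sum_congr rfl fun _ _ => Finset.sum_comm).trans ?_
  rw [Finset.sum_comm]

lemma AA_pi {m : ℕ} (v : Fin (m + 1) → Fin (m + 1)) (G) (π : Perm (Fin m)) :
    AA v G = AA v (fun f u => G (fun s => f (π s)) (fun s => u (lft π s))) :=
  reindex_pi G v π

lemma AA_sigma {m : ℕ} (v : Fin (m + 1) → Fin (m + 1)) (G) (c : Perm (Fin (m + 1)))
    (hc : sg c = 1) :
    AA v G = AA v (fun f u => G f (fun s => u (c s))) := by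
  simp only [AA]
  refine Finset.sum_congr rfl fun τ _ => ?_
  rw [alt_reindex (fun σ : Perm (Fin (m + 1)) => G τ (fun s => v (σ s))) c, hc, one_mul]
  rfl

lemma AA_trace {m k : ℕ} (h : 2 * k ≤ m) (W : Fin (m + 1) → Mt m)
    (O : Fin (m + 1) → Fin (m + 1) → Mt m) (hW : ∀ i α, W i α α = 0)
    (v : Fin (m + 1) → Fin (m + 1)) :
    AA v (fun f u => ∑ p, ∑ g : Fin m, W (u 0) (f p).castSucc g.castSucc *
        FF h W O u (Function.update f p g)) = 0 := by
  simp only [AA]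
  simp only [Finset.mul_sum (s := (univ : Finset (Perm (Fin (m+1)))))]
  rw [Finset.sum_comm]
  refine Finset.sum_eq_zero fun σ _ => ?_
  have := trace_cancel (fun a b => W (v (σ 0)) a.castSucc b.castSucc) (fun a => hW _ _)
    (FF h W O (fun s => v (σ s)))
  rw [← mul_zero (sg σ), ← this, Finset.mul_sum]
  refine Finset.sum_congr rfl fun τ _ => ?_
  ring

lemma AA_TA' {m k : ℕ} (h : 2 * k ≤ m) (W : Fin (m + 1) → Mt m)
    (O : Fin (m + 1) → Fin (m + 1) → Mt m)
    (hOa : ∀ i j α β, O i j α β = - O i j β α) (hOb : ∀ i j α β, O i j α β = - O j i α β)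
    (v : Fin (m + 1) → Fin (m + 1)) (a : Fin k) :
    AA v (TA' h W O a) = AA v (TA h W O a) := by
  rw [AA_pi v _ (swap (sA h a) (sA' h a))]
  congr 1
  funext f u
  simp only [TA, TA', lft_zero, lft_succ, swap_apply_left, swap_apply_right]
  have : RO h W O (fun s => f (swap (sA h a) (sA' h a) s))
      (fun s => u (lft (swap (sA h a) (sA' h a)) s)) a = RO h W O f u a := by
    simp only [RO]
    congr 1
    · refine Finset.prod_congr rfl fun a' ha' => ?_
      have ne : a' ≠ a := (Finset.mem_erase.mp ha').1
      simp only [fO, lft_succ]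
      rw [swap_apply_of_ne_of_ne (by simpa [sA_inj] using ne) (sA_ne_sA' h _ _),
        swap_apply_of_ne_of_ne (sA_ne_sA' h _ _).symm (by simpa [sA'_inj] using ne)]
    · refine Finset.prod_congr rfl fun b _ => ?_
      simp only [fW, lft_succ]
      rw [swap_apply_of_ne_of_ne (sA_ne_sB h _ _).symm (sA'_ne_sB h _ _).symm]
  rw [this, hOa _ _ (Fin.last m), hOb (u (sA' h a).succ)]
  ring

lemma AA_TA_eq {m k : ℕ} (h : 2 * k ≤ m) (W : Fin (m + 1) → Mt m)
    (O : Fin (m + 1) → Fin (m + 1) → Mt m)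
    (v : Fin (m + 1) → Fin (m + 1)) (a l : Fin k) :
    AA v (TA h W O a) = AA v (TA h W O l) := by
  set π : Perm (Fin m) := swap (sA h a) (sA h l) * swap (sA' h a) (sA' h l) with hπ
  have p1 : ∀ a', π (sA h a') = sA h (swap a l a') := by
    intro a'
    rw [hπ, Perm.mul_apply, swap_apply_of_ne_of_ne (sA_ne_sA' h _ _) (sA_ne_sA' h _ _)]
    simp only [swap_apply_def, sA_inj]
    split_ifs <;> rfl
  have p2 : ∀ a', π (sA' h a') = sA' h (swap a l a') := by
    intro a'
    have : swap (sA' h a) (sA' h l) (sA' h a') = sA' h (swap a l a') := by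
      simp only [swap_apply_def, sA'_inj]
      split_ifs <;> rfl
    rw [hπ, Perm.mul_apply, this,
      swap_apply_of_ne_of_ne (sA_ne_sA' h _ _).symm (sA_ne_sA' h _ _).symm]
  have p3 : ∀ b, π (sB h b) = sB h b := by
    intro b
    rw [hπ, Perm.mul_apply,
      swap_apply_of_ne_of_ne (sA'_ne_sB h _ _).symm (sA'_ne_sB h _ _).symm,
      swap_apply_of_ne_of_ne (sA_ne_sB h _ _).symm (sA_ne_sB h _ _).symm]
  rw [AA_pi v _ π]
  congr 1
  funext f u
  simp only [TA, lft_zero, lft_succ, p1, p2, swap_apply_left, RO]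
  congr 2
  · refine Finset.prod_equiv (swap a l) ?_ ?_
    · intro i
      simp only [mem_erase, mem_univ, and_true]
      rw [not_iff_not, ← Equiv.apply_eq_iff_eq (swap a l), swap_apply_left]
    · intro i _
      simp only [fO, lft_succ, p1, p2]
  · refine Finset.prod_congr rfl fun b _ => ?_
    simp only [fW, lft_succ, p3]

lemma AA_TB_eq {m k : ℕ} (h : 2 * k ≤ m) (W : Fin (m + 1) → Mt m)
    (O : Fin (m + 1) → Fin (m + 1) → Mt m)
    (v : Fin (m + 1) → Fin (m + 1)) (b l : Fin (m - 2 * k)) :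
    AA v (TB h W O b) = AA v (TB h W O l) := by
  set π : Perm (Fin m) := swap (sB h b) (sB h l) with hπ
  have p1 : ∀ a', π (sA h a') = sA h a' := by
    intro a'
    rw [hπ, swap_apply_of_ne_of_ne (sA_ne_sB h _ _) (sA_ne_sB h _ _)]
  have p2 : ∀ a', π (sA' h a') = sA' h a' := by
    intro a'
    rw [hπ, swap_apply_of_ne_of_ne (sA'_ne_sB h _ _) (sA'_ne_sB h _ _)]
  have p3 : ∀ b', π (sB h b') = sB h (swap b l b') := by
    intro b'
    rw [hπ]
    simp only [swap_apply_def, sB_inj]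
    split_ifs <;> rfl
  rw [AA_pi v _ π]
  congr 1
  funext f u
  simp only [TB, lft_zero, lft_succ, p3, swap_apply_left, RB]
  congr 2
  · refine Finset.prod_congr rfl fun a _ => ?_
    simp only [fO, lft_succ, p1, p2]
  · refine Finset.prod_equiv (swap b l) ?_ ?_
    · intro i
      simp only [mem_erase, mem_univ, and_true]
      rw [not_iff_not, ← Equiv.apply_eq_iff_eq (swap b l), swap_apply_left]
    · intro i _
      simp only [fW, lft_succ, p3]

/-- the integrand of `Psi` -/
def PS {m k : ℕ} (h : 2 * k + 1 ≤ m) (W : Fin (m + 1) → Mt m)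
    (O : Fin (m + 1) → Fin (m + 1) → Mt m)
    (f : Fin m → Fin m) (u : Fin (m + 1) → Fin (m + 1)) : ℝ :=
  (∏ a : Fin k, O (u ⟨2 * (a : ℕ), by have := a.isLt; omega⟩)
      (u ⟨2 * (a : ℕ) + 1, by have := a.isLt; omega⟩)
      (Fin.castSucc (f ⟨2 * (a : ℕ), by have := a.isLt; omega⟩))
      (Fin.castSucc (f ⟨2 * (a : ℕ) + 1, by have := a.isLt; omega⟩)))
    * O (u ⟨2 * k, by omega⟩) (u ⟨2 * k + 1, by omega⟩)
        (Fin.castSucc (f ⟨2 * k, by omega⟩)) (Fin.last m)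
    * (∏ b : Fin (m - 2 * k - 1),
        W (u ⟨2 * k + 2 + (b : ℕ), by have := b.isLt; omega⟩)
          (Fin.castSucc (f ⟨2 * k + 1 + (b : ℕ), by have := b.isLt; omega⟩)) (Fin.last m))

lemma cyc_lt {N : ℕ} (c j : ℕ) (hc : c < N + 1) (hj : j < c) :
    Fin.cycleRange (⟨c, hc⟩ : Fin (N + 1)) ⟨j, by omega⟩ = ⟨j + 1, by omega⟩ := by
  rw [Fin.cycleRange_of_lt (by simpa [Fin.lt_def] using hj)]
  ext
  rw [Fin.val_add_one_of_lt]
  simp only [Fin.lt_def, Fin.val_last]; omega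

lemma cyc_gt {N : ℕ} (c j : ℕ) (hc : c < N + 1) (hj : c < j) (hj' : j < N + 1) :
    Fin.cycleRange (⟨c, hc⟩ : Fin (N + 1)) ⟨j, hj'⟩ = ⟨j, hj'⟩ :=
  Fin.cycleRange_of_gt (by simpa [Fin.lt_def] using hj)

lemma cyc_eq {N : ℕ} (c : ℕ) (hc : c < N + 1) :
    Fin.cycleRange (⟨c, hc⟩ : Fin (N + 1)) ⟨c, hc⟩ = 0 := Fin.cycleRange_self _

lemma prod_succ' {N N' : ℕ} (hN : N = N' + 1) (g : Fin N → ℝ) :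
    ∏ b, g b = g ⟨0, by omega⟩ * ∏ b : Fin N', g ⟨b + 1, by have := b.isLt; omega⟩ := by
  subst hN
  rw [Fin.prod_univ_succ]; rfl

lemma prod_erase_zero {N N' : ℕ} (hN : N = N' + 1) (g : Fin N → ℝ) :
    ∏ b ∈ univ.erase ⟨0, by omega⟩, g b = ∏ b : Fin N', g ⟨b + 1, by have := b.isLt; omega⟩ := by
  subst hN
  symm
  refine Finset.prod_bij (fun b _ => b.succ) ?_ ?_ ?_ ?_
  · intro b _; simp [Fin.ext_iff]
  · intro a _ b _ hab; exact Fin.succ_injective _ hab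
  · intro b hb
    have : b ≠ 0 := (Finset.mem_erase.mp hb).1
    exact ⟨b.pred this, mem_univ _, by simp⟩
  · intro b _; rfl

lemma prod_erase_last {N : ℕ} (g : Fin (N + 1) → ℝ) :
    ∏ b ∈ univ.erase (Fin.last N), g b = ∏ b : Fin N, g b.castSucc := by
  symm
  refine Finset.prod_bij (fun b _ => b.castSucc) ?_ ?_ ?_ ?_
  · intro b _; simp [(Fin.castSucc_lt_last b).ne]
  · intro a _ b _ hab; exact Fin.castSucc_injective _ hab
  · intro b hb
    have : b ≠ Fin.last N := (Finset.mem_erase.mp hb).1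
    exact ⟨b.castPred this, mem_univ _, by simp⟩
  · intro b _; rfl

lemma sg_cyc {N : ℕ} (k : ℕ) (hc : 2 * k < N + 1) :
    sg (Fin.cycleRange (⟨2 * k, hc⟩ : Fin (N + 1))) = 1 := by
  simp [sg, Fin.sign_cycleRange]

lemma AA_TB_PS {m k : ℕ} (h : 2 * k + 1 ≤ m) (h' : 2 * k ≤ m) (W : Fin (m + 1) → Mt m)
    (O : Fin (m + 1) → Fin (m + 1) → Mt m)
    (v : Fin (m + 1) → Fin (m + 1)) :
    AA v (TB h' W O ⟨0, by omega⟩) = AA v (PS h W O) := by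
  rw [AA_sigma v (PS h W O) (Fin.cycleRange ⟨2 * k, by omega⟩) (sg_cyc _ _)]
  congr 1
  funext f u
  simp only [TB, RB, PS]
  rw [prod_erase_zero (N' := m - 2 * k - 1) (by omega), cyc_eq, cyc_gt _ (2 * k + 1) _ (by omega)]
  rw [mul_left_comm, mul_assoc]
  congr 1
  · refine Finset.prod_congr rfl fun a _ => ?_
    have := a.isLt
    rw [cyc_lt _ _ _ (by omega), cyc_lt _ _ _ (by omega)]
    rfl
  · congr 1
    refine Finset.prod_congr rfl fun b _ => ?_
    have := b.isLt
    rw [cyc_gt _ _ _ (by omega)]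
    simp only [fW, sB]
    congr 3 <;> congr 1 <;> (try simp only [Fin.succ_mk, Fin.mk.injEq]) <;> omega

lemma AA_TA_PS {m k : ℕ} (h : 2 * k + 1 ≤ m) (h' : 2 * (k + 1) ≤ m) (W : Fin (m + 1) → Mt m)
    (O : Fin (m + 1) → Fin (m + 1) → Mt m)
    (v : Fin (m + 1) → Fin (m + 1)) :
    AA v (TA h' W O (Fin.last k)) = AA v (PS h W O) := by
  rw [AA_sigma v (PS h W O) (Fin.cycleRange ⟨2 * (k + 1), by omega⟩) (sg_cyc _ _)]
  congr 1
  funext f u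
  simp only [TA, RO, PS]
  rw [prod_erase_last, prod_succ' (N := m - 2 * k - 1) (N' := m - 2 * (k + 1)) (by omega),
    cyc_lt _ (2 * k) _ (by omega), cyc_lt _ (2 * k + 1) _ (by omega)]
  have e1 : ∏ a : Fin k, fO h' O f u a.castSucc =
      ∏ a : Fin k, O (u (Fin.cycleRange ⟨2 * (k + 1), by omega⟩
        ⟨2 * (a : ℕ), by have := a.isLt; omega⟩))
      (u (Fin.cycleRange ⟨2 * (k + 1), by omega⟩ ⟨2 * (a : ℕ) + 1, by have := a.isLt; omega⟩))
      (Fin.castSucc (f ⟨2 * (a : ℕ), by have := a.isLt; omega⟩))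
      (Fin.castSucc (f ⟨2 * (a : ℕ) + 1, by have := a.isLt; omega⟩)) := by
    refine Finset.prod_congr rfl fun a _ => ?_
    have := a.isLt
    rw [cyc_lt _ _ _ (by omega), cyc_lt _ _ _ (by omega)]
    rfl
  have e2 : ∏ b, fW h' W f u b = ∏ b : Fin (m - 2 * (k + 1)),
      W (u (Fin.cycleRange ⟨2 * (k + 1), by omega⟩
        ⟨2 * k + 2 + ((b : ℕ) + 1), by have := b.isLt; omega⟩))
          (Fin.castSucc (f ⟨2 * k + 1 + ((b : ℕ) + 1), by have := b.isLt; omega⟩)) (Fin.last m) := by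
    refine Finset.prod_congr rfl fun b _ => ?_
    have := b.isLt
    rw [cyc_gt _ _ _ (by omega)]
    simp only [fW, sB]
    congr 3 <;> congr 1 <;> (try simp only [Fin.succ_mk, Fin.mk.injEq]) <;> omega
  rw [e1, e2]
  have e3 : Fin.cycleRange (⟨2 * (k + 1), by omega⟩ : Fin (m + 1)) ⟨2 * k + 2 + 0, by omega⟩ = 0 :=
    cyc_eq _ _
  rw [e3]
  have e4 : sA h' (Fin.last k) = ⟨2 * k, by omega⟩ := rfl
  have e5 : sA' h' (Fin.last k) = ⟨2 * k + 1 + 0, by omega⟩ := rfl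
  rw [e4, e5]
  simp only [Fin.succ_mk, add_zero]
  ring

/-- algebraic core -/
lemma core_alg {m k : ℕ} (h : 2 * k + 1 ≤ m) (h' : 2 * k ≤ m) (W : Fin (m + 1) → Mt m)
    (O D : Fin (m + 1) → Fin (m + 1) → Mt m) (P : Fin (m + 1) → Fin (m + 1) → Fin (m + 1) → Mt m)
    (hO : ∀ i j, O i j = D i j - D j i - (W i * W j - W j * W i))
    (hWa : ∀ i α β, W i α β = - W i β α)
    (hDa : ∀ i j α β, D i j α β = - D i j β α)
    (hP : ∀ i j l, P i j l + P j l i + P l i j =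
      (W i * O j l - O j l * W i) + (W j * O l i - O l i * W j) + (W l * O i j - O i j * W l))
    (v : Fin (m + 1) → Fin (m + 1)) :
    AA v (LL h' W O D P) =
      (if hk : k = 0 then 0 else 2 * (k : ℝ) * AA v (PS (k := k - 1) (by omega) W O)) +
      ((m : ℝ) - 2 * k) / 2 * AA v (PS h W O) := by
  have hW0 : ∀ i α, W i α α = 0 := fun i α => by have := hWa i α α; linarith
  have hOb : ∀ i j α β, O i j α β = - O j i α β := by
    intro i j α β
    rw [hO i j, hO j i]; simp only [Matrix.sub_apply]; ring
  have hOa : ∀ i j α β, O i j α β = - O i j β α := by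
    intro i j α β
    rw [hO i j]; simp only [Matrix.sub_apply, Matrix.mul_apply]
    rw [hDa i j α β, hDa j i α β]
    have e : ∀ i j, ∑ x, W i α x * W j x β = ∑ x, W j β x * W i x α := by
      intro i j
      refine Finset.sum_congr rfl fun x _ => ?_
      rw [hWa i α x, hWa j x β]; ring
    rw [e i j, e j i]; ring
  have s1 : AA v (LL h' W O D P) = AA v (LB h' W O) := by
    simp only [AA]
    refine Finset.sum_congr rfl fun τ _ => ?_
    rw [LL_LB h' W O D P hO hWa hP]
  have s2 : LB h' W O = _ := funext fun f => funext fun u => LB_eq h' W O (fun i => hW0 i _) f u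
  rw [s1, s2, AA_add, AA_add, AA_smul, AA_trace h' W O hW0, AA_sum, AA_sum, zero_add]
  congr 1
  · by_cases hk : k = 0
    · subst hk; simp
    · rw [dif_neg hk]
      obtain ⟨k', rfl⟩ : ∃ k', k = k' + 1 := ⟨k - 1, by omega⟩
      have : ∀ a, AA v (fun f u => TA h' W O a f u + TA' h' W O a f u) =
          2 * AA v (PS (k := k') (by omega) W O) := by
        intro a
        rw [AA_add, AA_TA' h' W O hOa hOb, AA_TA_eq h' W O v a (Fin.last k'),
          AA_TA_PS (by omega) h']
        ring
      simp only [this]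
      simp only [Finset.sum_const, card_univ, Fintype.card_fin, nsmul_eq_mul]
      change _ = 2 * ((k' + 1 : ℕ) : ℝ) * AA v (PS (k := k') _ W O)
      ring
  · have : ∀ b, AA v (fun f u => TB h' W O b f u) = AA v (PS h W O) := by
      intro b
      rw [← AA_TB_PS h h']
      exact AA_TB_eq h' W O v b _
    simp only [this]
    simp only [Finset.sum_const, card_univ, Fintype.card_fin, nsmul_eq_mul]
    rw [Nat.cast_sub h']; push_cast; ring

lemma pder_sub' {n : ℕ} (i : Fin n) {f g : Euc n → ℝ} (hf : Differentiable ℝ f)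
    (hg : Differentiable ℝ g) (x) :
    pder i (fun y => f y - g y) x = pder i f x - pder i g x := by
  simp only [pder]
  rw [fderiv_fun_sub (hf x) (hg x)]; rfl

lemma pder_mul' {n : ℕ} (i : Fin n) {f g : Euc n → ℝ} (hf : Differentiable ℝ f)
    (hg : Differentiable ℝ g) (x) :
    pder i (fun y => f y * g y) x = pder i f x * g x + f x * pder i g x := by
  simp only [pder]
  rw [fderiv_fun_mul (hf x) (hg x)]
  simp; ring

lemma pder_sum' {n : ℕ} {ι : Type*} (s : Finset ι) (i : Fin n) {f : ι → Euc n → ℝ}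
    (hf : ∀ j, Differentiable ℝ (f j)) (x) :
    pder i (fun y => ∑ j ∈ s, f j y) x = ∑ j ∈ s, pder i (f j) x := by
  simp only [pder]
  rw [fderiv_fun_sum (fun j _ => hf j x)]
  simp

lemma pder_const_mul' {n : ℕ} (i : Fin n) (c : ℝ) {f : Euc n → ℝ} (hf : Differentiable ℝ f) (x) :
    pder i (fun y => c * f y) x = c * pder i f x := by
  simp only [pder]
  rw [fderiv_const_mul (hf x)]; simp

lemma pder_prod' {n : ℕ} {ι : Type*} [DecidableEq ι] (s : Finset ι) (i : Fin n)
    {f : ι → Euc n → ℝ} (hf : ∀ j, Differentiable ℝ (f j)) (x) :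
    pder i (fun y => ∏ j ∈ s, f j y) x = ∑ j ∈ s, pder i (f j) x * ∏ j' ∈ s.erase j, f j' x := by
  simp only [pder]
  rw [(HasFDerivAt.finsetProd (fun j _ => (hf j x).hasFDerivAt)).fderiv]
  simp [mul_comm]

lemma pder_smooth {n : ℕ} (i : Fin n) {f : Euc n → ℝ} (hf : ContDiff ℝ (⊤ : ℕ∞) f) :
    ContDiff ℝ (⊤ : ℕ∞) (fun y => pder i f y) := by
  simp only [pder]
  exact (hf.fderiv_right (m := (⊤ : ℕ∞)) (by simp)).clm_apply contDiff_const

lemma smooth_diff {n : ℕ} {f : Euc n → ℝ} (hf : ContDiff ℝ (⊤ : ℕ∞) f) : Differentiable ℝ f :=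
  hf.differentiable (by simp)

lemma pder_comm {n : ℕ} (i j : Fin n) {f : Euc n → ℝ} (hf : ContDiff ℝ (⊤ : ℕ∞) f) (x) :
    pder i (fun y => pder j f y) x = pder j (fun y => pder i f y) x := by
  have hd : Differentiable ℝ (fderiv ℝ f) :=
    (hf.fderiv_right (m := (⊤ : ℕ∞)) (by simp)).differentiable (by simp)
  have e : ∀ i j : Fin n, pder i (fun y => pder j f y) x =
      fderiv ℝ (fderiv ℝ f) x (EuclideanSpace.single i 1) (EuclideanSpace.single j 1) := by
    intro i j
    simp only [pder]
    rw [fderiv_clm_apply (hd x) (differentiableAt_const _)]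
    simp
  rw [e, e]
  have := (hf.contDiffAt (x := x)).isSymmSndFDerivAt (by simp only [minSmoothness_of_isRCLikeNormedField]; exact WithTop.coe_le_coe.mpr (le_top (a := (2 : ℕ∞))))
  exact this _ _

lemma omega_apply {m : ℕ}
    (ωc : Fin (m + 1) → Fin (m + 1) → Form (m + 1) 1)
    (Ω : Fin (m + 1) → Fin (m + 1) → Form (m + 1) 2)
    (hΩ : ∀ α β, Ω α β = extd (ωc α β) - ∑ γ : Fin (m + 1), wedge (ωc α γ) (ωc γ β))
    (α β i j : Fin (m + 1)) (x : Euc (m + 1)) :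
    Ω α β x ![i, j] = pder i (fun y => ωc α β y ![j]) x - pder j (fun y => ωc α β y ![i]) x -
      ∑ γ, (ωc α γ x ![i] * ωc γ β x ![j] - ωc α γ x ![j] * ωc γ β x ![i]) := by
  rw [hΩ]
  simp only [Pi.sub_apply, Finset.sum_apply]
  congr 1
  · have h0 : (![i, j] : Fin 2 → Fin (m + 1)) ∘ (0 : Fin 2).succAbove = ![j] := by
      funext s; fin_cases s; rfl
    have h1 : (![i, j] : Fin 2 → Fin (m + 1)) ∘ (1 : Fin 2).succAbove = ![i] := by
      funext s; fin_cases s; rfl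
    change ∑ s : Fin 2, _ = _
    rw [Fin.sum_univ_two]
    simp only [h0, h1]
    simp
    ring
  · refine Finset.sum_congr rfl fun γ _ => ?_
    simp only [wedge]
    have hu : (Finset.univ : Finset (Perm (Fin (1 + 1)))) = {1, swap 0 1} := by decide
    rw [hu, Finset.sum_insert (by decide), Finset.sum_singleton]
    have a1 : (fun s : Fin 1 => (![i, j] : Fin 2 → Fin (m + 1))
        ((1 : Perm (Fin (1 + 1))) (Fin.castAdd 1 s))) = ![i] := by
      funext s; fin_cases s; rfl
    have a2 : (fun s : Fin 1 => (![i, j] : Fin 2 → Fin (m + 1))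
        ((1 : Perm (Fin (1 + 1))) (Fin.natAdd 1 s))) = ![j] := by
      funext s; fin_cases s; rfl
    have a3 : (fun s : Fin 1 => (![i, j] : Fin 2 → Fin (m + 1))
        ((swap 0 1 : Perm (Fin (1 + 1))) (Fin.castAdd 1 s))) = ![j] := by
      funext s; fin_cases s; rfl
    have a4 : (fun s : Fin 1 => (![i, j] : Fin 2 → Fin (m + 1))
        ((swap 0 1 : Perm (Fin (1 + 1))) (Fin.natAdd 1 s))) = ![i] := by
      funext s; fin_cases s; rfl
    have sw : Perm.sign (swap 0 1 : Perm (Fin (1 + 1))) = -1 := by decide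
    rw [a1, a2, a3, a4, sw]
    simp
    ring

section geom
variable {m : ℕ} (ωc : Fin (m + 1) → Fin (m + 1) → Form (m + 1) 1)
    (Ω : Fin (m + 1) → Fin (m + 1) → Form (m + 1) 2) (x : Euc (m + 1))

def gW (i : Fin (m + 1)) : Mt m := fun α β => ωc α β x ![i]
def gO (i j : Fin (m + 1)) : Mt m := fun α β => Ω α β x ![i, j]
def gD (i j : Fin (m + 1)) : Mt m := fun α β => pder i (fun y => ωc α β y ![j]) x
def gP (l i j : Fin (m + 1)) : Mt m := fun α β => pder l (fun y => Ω α β y ![i, j]) x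
def gDD (l i j : Fin (m + 1)) : Mt m :=
  fun α β => pder l (fun z => pder i (fun y => ωc α β y ![j]) z) x
end geom

lemma gO_eq {m : ℕ} (ωc : Fin (m + 1) → Fin (m + 1) → Form (m + 1) 1)
    (Ω : Fin (m + 1) → Fin (m + 1) → Form (m + 1) 2)
    (hΩ : ∀ α β, Ω α β = extd (ωc α β) - ∑ γ : Fin (m + 1), wedge (ωc α γ) (ωc γ β))
    (x : Euc (m + 1)) (i j : Fin (m + 1)) :
    gO Ω x i j = gD ωc x i j - gD ωc x j i -
      (gW ωc x i * gW ωc x j - gW ωc x j * gW ωc x i) := by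
  ext α β
  simp only [Matrix.sub_apply, Matrix.mul_apply, gO, gD, gW]
  rw [omega_apply ωc Ω hΩ, Finset.sum_sub_distrib]

lemma gP_eq {m : ℕ} (ωc : Fin (m + 1) → Fin (m + 1) → Form (m + 1) 1)
    (Ω : Fin (m + 1) → Fin (m + 1) → Form (m + 1) 2)
    (hsmooth : ∀ (α β : Fin (m + 1)) (v : Fin 1 → Fin (m + 1)),
      ContDiff ℝ (⊤ : ℕ∞) (fun x => ωc α β x v))
    (hΩ : ∀ α β, Ω α β = extd (ωc α β) - ∑ γ : Fin (m + 1), wedge (ωc α γ) (ωc γ β))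
    (x : Euc (m + 1)) (l i j : Fin (m + 1)) :
    gP Ω x l i j = gDD ωc x l i j - gDD ωc x l j i -
      ((gD ωc x l i * gW ωc x j + gW ωc x i * gD ωc x l j) -
        (gD ωc x l j * gW ωc x i + gW ωc x j * gD ωc x l i)) := by
  have hd : ∀ α β v, Differentiable ℝ (fun x => ωc α β x v) :=
    fun α β v => smooth_diff (hsmooth α β v)
  have hdd : ∀ i α β v, Differentiable ℝ (fun z => pder i (fun x => ωc α β x v) z) :=
    fun i α β v => smooth_diff (pder_smooth i (hsmooth α β v))
  ext α β
  simp only [Matrix.sub_apply, Matrix.add_apply, Matrix.mul_apply, gP, gDD, gD, gW]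
  simp only [omega_apply ωc Ω hΩ]
  have hm : ∀ γ i j, Differentiable ℝ (fun y => ωc α γ y ![i] * ωc γ β y ![j]) :=
    fun γ i j => (hd _ _ _).mul (hd _ _ _)
  have hs1 : Differentiable ℝ (fun y => pder i (fun y => ωc α β y ![j]) y -
      pder j (fun y => ωc α β y ![i]) y) := (hdd _ _ _ _).sub (hdd _ _ _ _)
  have hs2 : ∀ γ, Differentiable ℝ (fun y => ωc α γ y ![i] * ωc γ β y ![j] -
      ωc α γ y ![j] * ωc γ β y ![i]) := fun γ => (hm γ i j).sub (hm γ j i)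
  rw [pder_sub' l hs1 (Differentiable.fun_sum fun γ _ => hs2 γ),
    pder_sub' l (hdd _ _ _ _) (hdd _ _ _ _), pder_sum' univ l hs2]
  congr 1
  simp only [← Finset.sum_add_distrib, ← Finset.sum_sub_distrib]
  refine Finset.sum_congr rfl fun γ _ => ?_
  rw [pder_sub' l (hm γ i j) (hm γ j i), pder_mul' l (hd _ _ _) (hd _ _ _),
    pder_mul' l (hd _ _ _) (hd _ _ _)]

lemma gBianchi {m : ℕ} (ωc : Fin (m + 1) → Fin (m + 1) → Form (m + 1) 1)
    (Ω : Fin (m + 1) → Fin (m + 1) → Form (m + 1) 2)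
    (hsmooth : ∀ (α β : Fin (m + 1)) (v : Fin 1 → Fin (m + 1)),
      ContDiff ℝ (⊤ : ℕ∞) (fun x => ωc α β x v))
    (hΩ : ∀ α β, Ω α β = extd (ωc α β) - ∑ γ : Fin (m + 1), wedge (ωc α γ) (ωc γ β))
    (x : Euc (m + 1)) (i j l : Fin (m + 1)) :
    gP Ω x i j l + gP Ω x j l i + gP Ω x l i j =
      (gW ωc x i * gO Ω x j l - gO Ω x j l * gW ωc x i) +
      (gW ωc x j * gO Ω x l i - gO Ω x l i * gW ωc x j) +
      (gW ωc x l * gO Ω x i j - gO Ω x i j * gW ωc x l) := by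
  have hc : ∀ a b c, gDD ωc x a b c = gDD ωc x b a c := by
    intro a b c
    ext α β
    exact pder_comm a b (hsmooth α β _) x
  simp only [gP_eq ωc Ω hsmooth hΩ, gO_eq ωc Ω hΩ]
  rw [hc j i l, hc l i j, hc l j i]
  noncomm_ring

lemma Omega_diff {m : ℕ} (ωc : Fin (m + 1) → Fin (m + 1) → Form (m + 1) 1)
    (Ω : Fin (m + 1) → Fin (m + 1) → Form (m + 1) 2)
    (hsmooth : ∀ (α β : Fin (m + 1)) (v : Fin 1 → Fin (m + 1)),
      ContDiff ℝ (⊤ : ℕ∞) (fun x => ωc α β x v))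
    (hΩ : ∀ α β, Ω α β = extd (ωc α β) - ∑ γ : Fin (m + 1), wedge (ωc α γ) (ωc γ β))
    (α β i j : Fin (m + 1)) : Differentiable ℝ (fun y => Ω α β y ![i, j]) := by
  have hd : ∀ α β v, Differentiable ℝ (fun x => ωc α β x v) :=
    fun α β v => smooth_diff (hsmooth α β v)
  have hdd : ∀ i α β v, Differentiable ℝ (fun z => pder i (fun x => ωc α β x v) z) :=
    fun i α β v => smooth_diff (pder_smooth i (hsmooth α β v))
  simp only [omega_apply ωc Ω hΩ]
  exact ((hdd _ _ _ _).sub (hdd _ _ _ _)).sub (Differentiable.fun_sum fun γ _ =>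
    ((hd _ _ _).mul (hd _ _ _)).sub ((hd _ _ _).mul (hd _ _ _)))

/-- Exterior derivative of `Phi` as a double alternation. -/
lemma extd_Phi {m k : ℕ} (h : 2 * k ≤ m) (ωc : Fin (m + 1) → Fin (m + 1) → Form (m + 1) 1)
    (Ω : Fin (m + 1) → Fin (m + 1) → Form (m + 1) 2)
    (hsmooth : ∀ (α β : Fin (m + 1)) (v : Fin 1 → Fin (m + 1)),
      ContDiff ℝ (⊤ : ℕ∞) (fun x => ωc α β x v))
    (hΩ : ∀ α β, Ω α β = extd (ωc α β) - ∑ γ : Fin (m + 1), wedge (ωc α γ) (ωc γ β))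
    (x : Euc (m + 1)) (v : Fin (m + 1) → Fin (m + 1)) :
    extd (Phi m k Ω ωc) x v = (2 ^ k : ℝ)⁻¹ *
      AA v (LL h (gW ωc x) (gO Ω x) (gD ωc x) (gP Ω x)) := by
  have hd : ∀ α β v, Differentiable ℝ (fun x => ωc α β x v) :=
    fun α β v => smooth_diff (hsmooth α β v)
  have hdO := Omega_diff ωc Ω hsmooth hΩ
  -- the product as a function of the point
  set Q : (Fin m → Fin m) → (Fin (m + 1) → Fin (m + 1)) → Euc (m + 1) → ℝ :=
    fun f u y => (∏ a : Fin k, fO h (gO Ω y) f u a) * ∏ b, fW h (gW ωc y) f u b with hQ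
  have hfO : ∀ f u (a : Fin k), Differentiable ℝ (fun y => fO h (gO Ω y) f u a) :=
    fun f u a => hdO _ _ _ _
  have hfW : ∀ f u b, Differentiable ℝ (fun y => fW h (gW ωc y) f u b) :=
    fun f u b => hd _ _ _
  have hp1 : ∀ f u, Differentiable ℝ (fun y => ∏ a : Fin k, fO h (gO Ω y) f u a) :=
    fun f u y => (HasFDerivAt.finsetProd fun a _ => (hfO f u a y).hasFDerivAt).differentiableAt
  have hp2 : ∀ f u, Differentiable ℝ (fun y => ∏ b, fW h (gW ωc y) f u b) :=
    fun f u y => (HasFDerivAt.finsetProd fun a _ => (hfW f u a y).hasFDerivAt).differentiableAt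
  have hQd : ∀ f u, Differentiable ℝ (Q f u) := fun f u => (hp1 f u).mul (hp2 f u)
  have hQp : ∀ f u, pder (u 0) (Q f u) x =
      LL h (gW ωc x) (gO Ω x) (gD ωc x) (gP Ω x) f u := by
    intro f u
    simp only [hQ]
    rw [pder_mul' _ (hp1 f u) (hp2 f u), pder_prod' _ _ (hfO f u), pder_prod' _ _ (hfW f u), LL,
      Finset.sum_mul, Finset.mul_sum]
    congr 1
    · refine Finset.sum_congr rfl fun a _ => ?_
      rw [RO, ← mul_assoc]; rfl
    · refine Finset.sum_congr rfl fun b _ => ?_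
      rw [RB, mul_left_comm]; rfl
  have hPhi : ∀ (i : Fin (m + 1)) y, Phi m k Ω ωc y (v ∘ i.succAbove) =
      (2 ^ k : ℝ)⁻¹ * ∑ τ : Perm (Fin m), ∑ σ : Perm (Fin m), (sg τ * sg σ) *
        Q τ (fun s => v ((i.cycleRange.symm * lft σ : Perm (Fin (m + 1))) s)) y := by
    intro i y
    rw [Phi, dif_pos h]
    congr 1
    refine Finset.sum_congr rfl fun τ _ => Finset.sum_congr rfl fun σ _ => ?_
    simp only [hQ, fO, fW, ext_slots]
    rw [mul_assoc]
    rfl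
  have step : ∀ i : Fin (m + 1), (-1 : ℝ) ^ (i : ℕ) *
      pder (v i) (fun y => Phi m k Ω ωc y (v ∘ i.succAbove)) x =
      (2 ^ k : ℝ)⁻¹ * ∑ τ : Perm (Fin m), sg τ * ∑ σ : Perm (Fin m), (-1 : ℝ) ^ (i : ℕ) * sg σ *
        LL h (gW ωc x) (gO Ω x) (gD ωc x) (gP Ω x) τ
          (fun s => v ((i.cycleRange.symm * lft σ : Perm (Fin (m + 1))) s)) := by
    intro i
    simp only [hPhi]
    rw [pder_const_mul', pder_sum']
    · rw [mul_left_comm]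
      congr 1
      rw [Finset.mul_sum]
      refine Finset.sum_congr rfl fun τ _ => ?_
      rw [pder_sum']
      · rw [Finset.mul_sum, Finset.mul_sum]
        refine Finset.sum_congr rfl fun σ _ => ?_
        rw [pder_const_mul' _ _ (hQd _ _), ← hQp]
        simp only [ext_zero]
        ring
      · exact fun σ => (hQd _ _).const_mul _
    · exact fun τ => Differentiable.fun_sum fun σ _ => (hQd _ _).const_mul _
    · exact Differentiable.fun_sum fun τ _ => Differentiable.fun_sum fun σ _ =>
        (hQd _ _).const_mul _
  simp only [extd]
  simp only [step]
  rw [← Finset.mul_sum, Finset.sum_comm]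
  congr 1
  simp only [AA]
  refine Finset.sum_congr rfl fun τ _ => ?_
  rw [← Finset.mul_sum]
  congr 1
  exact extd_reindex (fun ρ => LL h (gW ωc x) (gO Ω x) (gD ωc x) (gP Ω x) τ (fun s => v (ρ s)))

lemma Psi_AA {m k : ℕ} (h : 2 * k + 1 ≤ m) (ωc : Fin (m + 1) → Fin (m + 1) → Form (m + 1) 1)
    (Ω : Fin (m + 1) → Fin (m + 1) → Form (m + 1) 2)
    (x : Euc (m + 1)) (v : Fin (m + 1) → Fin (m + 1)) :
    Psi m k Ω ωc x v = (2 * ((k : ℝ) + 1)) * (2 ^ (k + 1) : ℝ)⁻¹ *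
      AA v (PS h (gW ωc x) (gO Ω x)) := by
  rw [Psi, dif_pos h]
  congr 1
  simp only [AA, Finset.mul_sum]
  refine Finset.sum_congr rfl fun τ _ => Finset.sum_congr rfl fun σ _ => ?_
  rw [PS, ← mul_assoc (sg τ), ← mul_assoc (sg τ * sg σ), ← mul_assoc (sg τ * sg σ)]
  rfl

end ChernAux

/-- Chern's transgression identity: on the unit sphere bundle of a Riemannian
`n`-manifold (`n = m + 1`), with antisymmetric Levi-Civita connection 1-forms `ωc` and
curvature 2-forms `Ω_{αβ} = dω_{αβ} − ω_{αγ} ∧ ω_{γβ}`, the forms `Φ_k` and `Ψ_k`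
satisfy `dΦ_k = Ψ_{k−1} + ((n−2k−1)/(2(k+1))) Ψ_k` for `k = 0, 1, ..., ⌊n/2⌋ − 1`
(with the convention `Ψ_{−1} = 0`). -/
theorem chern_transgression {m : ℕ}
    (ωc : Fin (m + 1) → Fin (m + 1) → Form (m + 1) 1)
    (Ω : Fin (m + 1) → Fin (m + 1) → Form (m + 1) 2)
    (hsmooth : ∀ (α β : Fin (m + 1)) (v : Fin 1 → Fin (m + 1)),
      ContDiff ℝ (⊤ : ℕ∞) (fun x => ωc α β x v))
    (hanti : ∀ α β, ωc α β = -ωc β α)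
    (hΩ : ∀ α β, Ω α β = extd (ωc α β) - ∑ γ : Fin (m + 1), wedge (ωc α γ) (ωc γ β)) :
    ∀ k : ℕ, k < (m + 1) / 2 →
      extd (Phi m k Ω ωc) =
        (if k = 0 then 0 else Psi m (k - 1) Ω ωc)
          + ((((m : ℝ) + 1) - 2 * k - 1) / (2 * ((k : ℝ) + 1))) • Psi m k Ω ωc := by
  intro k hk
  have h : 2 * k + 1 ≤ m := by omega
  have h' : 2 * k ≤ m := by omega
  funext x v
  have hWa : ∀ i α β, gW ωc x i α β = - gW ωc x i β α := by
    intro i α β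
    simp only [gW]
    rw [hanti α β]; rfl
  have hDa : ∀ i j α β, gD ωc x i j α β = - gD ωc x i j β α := by
    intro i j α β
    simp only [gD]
    rw [hanti α β]
    simp only [Pi.neg_apply, pder]
    rw [fderiv_fun_neg]; rfl
  rw [extd_Phi h' ωc Ω hsmooth hΩ, core_alg h h' (gW ωc x) (gO Ω x) (gD ωc x) (gP Ω x)
    (gO_eq ωc Ω hΩ x) hWa hDa (gBianchi ωc Ω hsmooth hΩ x)]
  simp only [Pi.add_apply, Pi.smul_apply, smul_eq_mul]
  rw [Psi_AA h, mul_add]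
  congr 1
  · by_cases hk0 : k = 0
    · simp [hk0]
    · rw [dif_neg hk0, if_neg hk0, Psi_AA (k := k - 1) (by omega)]
      obtain ⟨k', rfl⟩ : ∃ k', k = k' + 1 := ⟨k - 1, by omega⟩
      change _ = 2 * ((k' : ℝ) + 1) * (2 ^ (k' + 1))⁻¹ * AA v (PS (k := k') _ _ _)
      push_cast
      ring_nf
  · have : (k : ℝ) + 1 ≠ 0 := by positivity
    field_simp
    ring
end
end
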